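/- arXiv:1710.00198 — 6 statements merged into one kernel-verified Lean document; each statement's English description precedes it below -/
import Mathlib

section
/- Let θ : (−π, π) → ℝ be defined by θ(y) = (2y − sin(2y))/(2 sin²(y)) for y ≠ 0 and θ(0) = 0. Then θ is odd (θ(−y) = −θ(y) for all y ∈ (−π, π)), real-analytic on (−π, π), strictly increasing, and maps (−π, π) bijectively onto ℝ. -/
open Real

/-- The function θ : (−π, π) → ℝ, θ(y) = (2y − sin(2y))/(2 sin²(y)) for y ≠ 0, θ(0) = 0. -/
noncomputable def theta (y : ℝ) : ℝ :=
  if y = 0 then 0 else (2 * y - Real.sin (2 * y)) / (2 * Real.sin y ^ 2)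

theorem theta_zero : theta 0 = 0 := by simp [theta]

theorem theta_of_ne_zero {y : ℝ} (hy : y ≠ 0) :
    theta y = (2 * y - Real.sin (2 * y)) / (2 * Real.sin y ^ 2) := by
  simp [theta, hy]

theorem theta_neg (y : ℝ) : theta (-y) = -theta y := by
  rcases eq_or_ne y 0 with rfl | hy
  · simp [theta_zero]
  · rw [theta_of_ne_zero hy, theta_of_ne_zero (neg_ne_zero.mpr hy), mul_neg, Real.sin_neg,
      Real.sin_neg, neg_sq]
    ring

theorem abs_theta_le {y : ℝ} (hy : |y| ≤ 1 / 2) : |theta y| ≤ 4 * |y| := by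
  wlog h : 0 ≤ y generalizing y
  · have := this (y := -y) (by rwa [abs_neg]) (by linarith)
    rwa [theta_neg, abs_neg, abs_neg] at this
  rcases h.eq_or_lt with rfl | hpos
  · simp [theta_zero]
  rw [abs_of_pos hpos] at hy ⊢
  have hN : 2 * y - Real.sin (2 * y) ≤ 2 * y ^ 3 := by
    nlinarith [Real.sin_gt_sub_cube (x := 2 * y) (by linarith), pow_pos hpos 3]
  have hN0 : 0 ≤ 2 * y - Real.sin (2 * y) := by
    linarith [Real.sin_le (x := 2 * y) (by linarith)]
  have hs : y / 2 ≤ Real.sin y := by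
    have := Real.sin_gt_sub_cube hpos
    nlinarith [mul_pos hpos hpos]
  have hs2 : (y / 2) ^ 2 ≤ Real.sin y ^ 2 := by gcongr
  have hd : 0 < 2 * Real.sin y ^ 2 := by nlinarith [mul_pos hpos hpos]
  rw [theta_of_ne_zero hpos.ne', abs_of_nonneg (div_nonneg hN0 hd.le), div_le_iff₀ hd]
  nlinarith [mul_le_mul_of_nonneg_left hs2 hpos.le]

theorem continuousAt_theta_zero : ContinuousAt theta 0 := by
  rw [ContinuousAt, theta_zero]
  refine squeeze_zero_norm' (a := fun y => 4 * |y|) ?_ ?_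
  · filter_upwards [Metric.closedBall_mem_nhds (0 : ℝ) (by norm_num : (0 : ℝ) < 1 / 2)] with y hy
    exact abs_theta_le (by simpa using hy)
  · exact Continuous.tendsto' (by fun_prop) _ _ (by simp)

theorem theta_eventuallyEq {y : ℝ} (hy : y ≠ 0) :
    theta =ᶠ[nhds y] fun x => (2 * x - Real.sin (2 * x)) / (2 * Real.sin x ^ 2) := by
  filter_upwards [isOpen_ne.mem_nhds hy] with x hx using theta_of_ne_zero hx

theorem sin_ne_zero_of_mem_Ioo {y : ℝ} (hy : y ∈ Set.Ioo (-π) π) (h0 : y ≠ 0) :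
    Real.sin y ≠ 0 :=
  fun h => h0 ((Real.sin_eq_zero_iff_of_lt_of_lt hy.1 hy.2).mp h)

theorem analyticAt_theta_zero : AnalyticAt ℝ theta 0 := by
  refine MeromorphicAt.analyticAt ?_ continuousAt_theta_zero
  have hN : AnalyticAt ℝ (fun x : ℝ => 2 * x - Real.sin (2 * x)) 0 := by fun_prop
  have hD : AnalyticAt ℝ (fun x : ℝ => 2 * Real.sin x ^ 2) 0 := by fun_prop
  refine (hN.meromorphicAt.div hD.meromorphicAt).congr ?_
  filter_upwards [self_mem_nhdsWithin] with x hx using (theta_of_ne_zero hx).symm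

theorem analyticOnNhd_theta : AnalyticOnNhd ℝ theta (Set.Ioo (-π) π) := by
  intro y hy
  rcases eq_or_ne y 0 with rfl | h0
  · exact analyticAt_theta_zero
  · have hs := sin_ne_zero_of_mem_Ioo hy h0
    have hN : AnalyticAt ℝ (fun x : ℝ => 2 * x - Real.sin (2 * x)) y := by fun_prop
    have hD : AnalyticAt ℝ (fun x : ℝ => 2 * Real.sin x ^ 2) y := by fun_prop
    exact (hN.div hD (by positivity)).congr (theta_eventuallyEq h0).symm

theorem hasDerivAt_theta {y : ℝ} (hy : y ∈ Set.Ioo (-π) π) (h0 : y ≠ 0) :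
    HasDerivAt theta (2 * (Real.sin y - y * Real.cos y) / Real.sin y ^ 3) y := by
  have hs := sin_ne_zero_of_mem_Ioo hy h0
  have h2 : HasDerivAt (fun x : ℝ => 2 * x) 2 y := by
    simpa using (hasDerivAt_id y).const_mul (2 : ℝ)
  have hD : HasDerivAt (fun x => 2 * Real.sin x ^ 2) (4 * Real.sin y * Real.cos y) y :=
    (((Real.hasDerivAt_sin y).pow 2).const_mul 2).congr_deriv (by push_cast; ring)
  refine (((h2.sub h2.sin).div hD (by positivity)).congr_deriv ?_).congr_of_eventuallyEq
    (theta_eventuallyEq h0)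
  simp only [Pi.sub_apply]
  rw [Real.cos_two_mul, Real.sin_two_mul, div_eq_div_iff (by positivity) (by positivity)]
  ring

theorem mul_cos_lt_sin {y : ℝ} (h0 : 0 < y) (hpi : y < π) : y * Real.cos y < Real.sin y := by
  have hs := Real.sin_pos_of_pos_of_lt_pi h0 hpi
  rcases lt_or_ge y (π / 2) with h | h
  · have hc := Real.cos_pos_of_mem_Ioo ⟨by linarith, h⟩
    have := Real.lt_tan h0 h
    rwa [Real.tan_eq_sin_div_cos, lt_div_iff₀ hc] at this
  · have := Real.cos_nonpos_of_pi_div_two_le_of_le h (by linarith)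
    nlinarith

theorem strictMonoOn_theta_Ico : StrictMonoOn theta (Set.Ico 0 π) := by
  refine strictMonoOn_of_deriv_pos (convex_Ico 0 π) ?_ ?_
  · exact analyticOnNhd_theta.continuousOn.mono fun y hy => ⟨by linarith [hy.1, Real.pi_pos], hy.2⟩
  · intro y hy
    rw [interior_Ico] at hy
    rw [(hasDerivAt_theta ⟨by linarith [hy.1, Real.pi_pos], hy.2⟩ hy.1.ne').deriv]
    have hs := Real.sin_pos_of_pos_of_lt_pi hy.1 hy.2
    have := sub_pos.mpr (mul_cos_lt_sin hy.1 hy.2)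
    positivity

theorem strictMonoOn_theta : StrictMonoOn theta (Set.Ioo (-π) π) := by
  intro x hx y hy hxy
  have h0 : (0 : ℝ) ∈ Set.Ico 0 π := ⟨le_rfl, Real.pi_pos⟩
  rcases le_or_gt 0 x with hx0 | hx0
  · exact strictMonoOn_theta_Ico ⟨hx0, hx.2⟩ ⟨hx0.trans hxy.le, hy.2⟩ hxy
  have hx' : -x ∈ Set.Ico 0 π := ⟨by linarith, by linarith [hx.1]⟩
  rcases le_or_gt 0 y with hy0 | hy0
  · have h1 := strictMonoOn_theta_Ico h0 hx' (by linarith)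
    have h2 := strictMonoOn_theta_Ico.monotoneOn h0 ⟨hy0, hy.2⟩ hy0
    rw [theta_neg] at h1
    rw [theta_zero] at h1 h2
    linarith
  · have := strictMonoOn_theta_Ico ⟨by linarith, by linarith [hy.1]⟩ hx' (neg_lt_neg hxy)
    simpa [theta_neg] using this

theorem exists_le_theta {t : ℝ} (ht : 0 ≤ t) : ∃ y ∈ Set.Ico 0 π, t ≤ theta y := by
  have hpi := Real.pi_gt_three
  set u : ℝ := 1 / (t + 1) with hu
  have hu0 : 0 < u := by positivity
  have hu1 : u ≤ 1 := by
    rw [hu, div_le_one (by positivity)]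
    linarith
  have htu : t * u ≤ 1 := by
    rw [hu, mul_one_div, div_le_one (by positivity)]
    linarith
  refine ⟨π - u, ⟨by linarith, by linarith⟩, ?_⟩
  have hs0 : 0 < Real.sin u := Real.sin_pos_of_pos_of_lt_pi hu0 (by linarith)
  have hsu : Real.sin u ≤ u := Real.sin_le hu0.le
  have h2 : 0 ≤ Real.sin (2 * u) :=
    Real.sin_nonneg_of_nonneg_of_le_pi (by linarith) (by linarith)
  have hN : Real.sin (2 * (π - u)) = -Real.sin (2 * u) := by
    rw [mul_sub, Real.sin_two_pi_sub]
  rw [theta_of_ne_zero (by linarith), hN, Real.sin_pi_sub, le_div_iff₀ (by positivity)]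
  have hsq : Real.sin u ^ 2 ≤ u := by nlinarith
  nlinarith [mul_le_mul_of_nonneg_left hsq ht]

theorem surjOn_theta : Set.SurjOn theta (Set.Ioo (-π) π) Set.univ := by
  have key : ∀ t : ℝ, 0 ≤ t → ∃ y ∈ Set.Ioo (-π) π, theta y = t := by
    intro t ht
    obtain ⟨z, hz, htz⟩ := exists_le_theta ht
    have hsub : Set.Icc 0 z ⊆ Set.Ioo (-π) π := fun y hy =>
      ⟨by linarith [hy.1, Real.pi_pos], hy.2.trans_lt hz.2⟩
    obtain ⟨y, hy, rfl⟩ := intermediate_value_Icc hz.1 (analyticOnNhd_theta.continuousOn.mono hsub)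
      ⟨theta_zero.trans_le ht, htz⟩
    exact ⟨y, hsub hy, rfl⟩
  intro t _
  rcases le_total 0 t with ht | ht
  · exact key t ht
  · obtain ⟨y, hy, h⟩ := key (-t) (by linarith)
    exact ⟨-y, ⟨by linarith [hy.2], by linarith [hy.1]⟩, by rw [theta_neg, h, neg_neg]⟩

/-- θ is odd, real-analytic on (−π, π), strictly increasing on (−π, π),
and maps (−π, π) bijectively onto ℝ. -/
theorem theta_odd_analytic_strictMono_bijOn :
    (∀ y ∈ Set.Ioo (-π) π, theta (-y) = - theta y) ∧
    AnalyticOnNhd ℝ theta (Set.Ioo (-π) π) ∧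
    StrictMonoOn theta (Set.Ioo (-π) π) ∧
    Set.BijOn theta (Set.Ioo (-π) π) Set.univ :=
  ⟨fun y _ => theta_neg y, analyticOnNhd_theta, strictMonoOn_theta,
    Set.mapsTo_univ _ _, strictMonoOn_theta.injOn, surjOn_theta⟩
end

section
/- Let ω ∈ ℝ and define φ_ω(λ) = ωλ + iλ·coth(λ) for complex λ with sinh λ ≠ 0, extended by φ_ω(0) = i. Then φ_ω is holomorphic on ℂ ∖ πiℤ*, and for every λ with λ ∉ πiℤ and λ ≠ 0 its derivative satisfies φ_ω′(λ) = ω + i(sinh(2λ) − 2λ)/(2 sinh²(λ)), with φ_ω′(0) = ω. In particular, if ω ≥ 0 and y_ω = θ^{−1}(ω) ∈ [0, π), then φ_ω′(i·y_ω) = 0, i.e., i·y_ω is a stationary point of φ_ω. -/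
open Real Complex

/-- φ_ω(λ) = ωλ + iλ·coth(λ), extended by φ_ω(0) = i. -/
noncomputable def phiOm (ω : ℝ) (z : ℂ) : ℂ :=
  if z = 0 then Complex.I
  else (ω : ℂ) * z + Complex.I * z * (Complex.cosh z / Complex.sinh z)

theorem sinh_ne_zero_of_forall_ne {z : ℂ} (hz : ∀ k : ℤ, z ≠ (π : ℂ) * Complex.I * (k : ℂ)) :
    Complex.sinh z ≠ 0 := by
  intro h
  have hsin : Complex.sin (z * Complex.I) = 0 := by rw [Complex.sin_mul_I, h, zero_mul]
  obtain ⟨k, hk⟩ := Complex.sin_eq_zero_iff.mp hsin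
  apply hz (-k)
  push_cast
  linear_combination (-Complex.I) * hk + z * Complex.I_mul_I

theorem hasDerivAt_phiOm_of_ne_zero (ω : ℝ) {z : ℂ} (hz : z ≠ 0) (hs : Complex.sinh z ≠ 0) :
    HasDerivAt (phiOm ω)
      ((ω : ℂ) + Complex.I * (Complex.sinh (2 * z) - 2 * z) / (2 * Complex.sinh z ^ 2)) z := by
  have h := ((hasDerivAt_id z).const_mul (ω : ℂ)).add
    (((hasDerivAt_id z).const_mul Complex.I).mul
      ((Complex.hasDerivAt_cosh z).div (Complex.hasDerivAt_sinh z) hs))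
  refine (h.congr_of_eventuallyEq ?_).congr_deriv ?_
  · filter_upwards [isOpen_ne.mem_nhds hz] with w hw
    exact if_neg hw
  · simp only [id, Pi.div_apply]
    rw [Complex.sinh_two_mul]
    field_simp
    linear_combination (-z * Complex.I) * Complex.cosh_sq_sub_sinh_sq z

theorem hasDerivAt_dslope_sinh_zero : HasDerivAt (dslope Complex.sinh 0) 0 0 := by
  have hd : DifferentiableAt ℂ (dslope Complex.sinh 0) 0 :=
    ((Complex.differentiableOn_dslope Filter.univ_mem).mpr
      Complex.differentiable_sinh.differentiableOn).differentiableAt Filter.univ_mem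
  have heven : (fun z => dslope Complex.sinh 0 (-z)) = dslope Complex.sinh 0 := by
    funext z
    rcases eq_or_ne z 0 with rfl | hz
    · simp
    · rw [dslope_of_ne _ hz, dslope_of_ne _ (neg_ne_zero.mpr hz)]
      simp [slope_def_field, neg_div_neg_eq]
  have h0 : deriv (dslope Complex.sinh 0) 0 = 0 := by
    have h := deriv_comp_neg (f := dslope Complex.sinh 0) (x := 0)
    rw [heven, neg_zero] at h
    exact self_eq_neg.mp h
  exact hd.hasDerivAt.congr_deriv h0

theorem hasDerivAt_phiOm_zero (ω : ℝ) : HasDerivAt (phiOm ω) (ω : ℂ) 0 := by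
  have hs : dslope Complex.sinh 0 0 = 1 := by
    rw [dslope_same, (Complex.hasDerivAt_sinh 0).deriv, Complex.cosh_zero]
  have h := ((hasDerivAt_id (0 : ℂ)).const_mul (ω : ℂ)).add
    (((Complex.hasDerivAt_cosh 0).div hasDerivAt_dslope_sinh_zero
      (hs.symm ▸ one_ne_zero)).const_mul Complex.I)
  refine (h.congr_of_eventuallyEq (Filter.Eventually.of_forall fun z => ?_)).congr_deriv ?_
  · rcases eq_or_ne z 0 with rfl | hz
    · simp [phiOm]
    · simp [phiOm, hz, dslope_of_ne _ hz, slope_def_field]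
      field_simp
  · simp

/-- φ_ω is holomorphic on ℂ ∖ πiℤ*; for λ ∉ πiℤ its derivative is
ω + i(sinh(2λ) − 2λ)/(2 sinh²λ), and φ_ω′(0) = ω.  In particular, for ω ≥ 0 and
y_ω = θ⁻¹(ω) ∈ [0, π), the point i·y_ω is a stationary point of φ_ω. -/
theorem phiOm_holomorphic_deriv_stationary (ω : ℝ) :
    DifferentiableOn ℂ (phiOm ω)
      {z : ℂ | ∀ k : ℤ, k ≠ 0 → z ≠ (π : ℂ) * Complex.I * (k : ℂ)} ∧
    (∀ z : ℂ, (∀ k : ℤ, z ≠ (π : ℂ) * Complex.I * (k : ℂ)) →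
      HasDerivAt (phiOm ω)
        ((ω : ℂ) + Complex.I * (Complex.sinh (2 * z) - 2 * z) / (2 * Complex.sinh z ^ 2)) z) ∧
    HasDerivAt (phiOm ω) (ω : ℂ) 0 ∧
    (∀ yω : ℝ, 0 ≤ ω → yω ∈ Set.Ico 0 π → theta yω = ω →
      HasDerivAt (phiOm ω) 0 (Complex.I * (yω : ℂ))) := by
  have hne : ∀ z : ℂ, (∀ k : ℤ, z ≠ (π : ℂ) * Complex.I * (k : ℂ)) →
      HasDerivAt (phiOm ω)
        ((ω : ℂ) + Complex.I * (Complex.sinh (2 * z) - 2 * z) / (2 * Complex.sinh z ^ 2)) z :=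
    fun z hz => hasDerivAt_phiOm_of_ne_zero ω (by simpa using hz 0) (sinh_ne_zero_of_forall_ne hz)
  refine ⟨fun z hz => ?_, hne, hasDerivAt_phiOm_zero ω, fun y _ hy hθ => ?_⟩
  · rcases eq_or_ne z 0 with rfl | h0
    · exact (hasDerivAt_phiOm_zero ω).differentiableAt.differentiableWithinAt
    · refine (hne z fun k => ?_).differentiableAt.differentiableWithinAt
      rcases eq_or_ne k 0 with rfl | hk
      · simpa using h0
      · exact hz k hk
  · rcases eq_or_ne y 0 with rfl | h0
    · have hω : ω = 0 := by simpa [theta] using hθ.symm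
      simpa [hω] using hasDerivAt_phiOm_zero ω
    · have hsin : (Complex.sin y) ≠ 0 := by
        exact_mod_cast (Real.sin_pos_of_pos_of_lt_pi (lt_of_le_of_ne hy.1 h0.symm) hy.2).ne'
      have hsinh : Complex.sinh (Complex.I * y) = Complex.sin y * Complex.I := by
        rw [mul_comm, Complex.sinh_mul_I]
      have hsinh2 : Complex.sinh (2 * (Complex.I * y)) = Complex.sin (2 * y) * Complex.I := by
        rw [← Complex.sinh_mul_I]
        ring_nf
      have hω : (ω : ℂ) = (2 * y - Complex.sin (2 * y)) / (2 * Complex.sin y ^ 2) := by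
        rw [← hθ, theta, if_neg h0]
        push_cast
        rfl
      refine (hasDerivAt_phiOm_of_ne_zero ω (by simpa using h0) ?_).congr_deriv ?_
      · rw [hsinh]
        exact mul_ne_zero hsin Complex.I_ne_zero
      · rw [hsinh, hsinh2, hω, mul_pow, Complex.I_sq]
        field_simp
        linear_combination (2 * y - Complex.sin (2 * y)) * Complex.I_sq
end

section
/- Let n, m ≥ 1 and k₁, k₂ ≥ 0 be integers, let ω ≥ 0 and R > 0. For z ∈ ℂ let G(z) = z·coth(z) and A(z) = z^{n+k₁}·cosh(z)^{k₁}/sinh(z)^{n+k₁}, both extended by G(0) = A(0) = 1; G and A are even. For μ ∈ ℂ^m put μ² = Σ_j μ_j², and whenever no square root of μ² lies in πiℤ* define φ_ω(μ) = ω·μ₁ + i·G(√(μ²)) and a_{k₁,k₂}(μ) = (−1)^{k₁} i^{k₂} A(√(μ²)) μ₁^{k₂}, where √(μ²) denotes either square root of μ² (the value is independent of the choice since G and A are even) and μ₁ is the first coordinate of μ. Then for every y ∈ [0, π), ∫_{ℝ^m} e^{iR·φ_ω(λ)} a_{k₁,k₂}(λ) dλ = ∫_{ℝ^m} e^{iR·φ_ω(λ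 + iy·u₁)} a_{k₁,k₂}(λ + iy·u₁) dλ, where u₁ is the first standard basis vector of ℝ^m. -/
open Real Complex MeasureTheory

/-- A fixed holomorphic square root: √w = w^{1/2} (principal branch). -/
noncomputable def sqC (w : ℂ) : ℂ := w ^ ((1 : ℂ) / 2)

/-- G(z) = z·coth(z), extended by G(0) = 1; an even function. -/
noncomputable def Gfun (z : ℂ) : ℂ :=
  if z = 0 then 1 else z * Complex.cosh z / Complex.sinh z

/-- A(z) = z^{n+k₁} cosh(z)^{k₁} / sinh(z)^{n+k₁}, extended by A(0) = 1; an even function. -/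
noncomputable def Afun (n k₁ : ℕ) (z : ℂ) : ℂ :=
  if z = 0 then 1
  else z ^ (n + k₁) * Complex.cosh z ^ k₁ / Complex.sinh z ^ (n + k₁)

/-- φ_ω(μ) = ω·μ₁ + i·G(√(μ²)), as a function of μ₁ and μ² = Σ μ_j². -/
noncomputable def phiVal (ω : ℝ) (mu1 sqmu : ℂ) : ℂ :=
  (ω : ℂ) * mu1 + Complex.I * Gfun (sqC sqmu)

/-- a_{k₁,k₂}(μ) = (−1)^{k₁} i^{k₂} A(√(μ²)) μ₁^{k₂}, as a function of μ₁ and μ². -/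
noncomputable def aVal (n k₁ k₂ : ℕ) (mu1 sqmu : ℂ) : ℂ :=
  (-1 : ℂ) ^ k₁ * Complex.I ^ k₂ * Afun n k₁ (sqC sqmu) * mu1 ^ k₂

open Set Filter Topology

/-- The entire function `sinh z / z`. -/
noncomputable def sinhQuot (z : ℂ) : ℂ := dslope Complex.sinh 0 z

lemma sinhQuot_zero : sinhQuot 0 = 1 := by
  simp [sinhQuot, dslope_same, (Complex.hasDerivAt_sinh 0).deriv]

lemma sinhQuot_of_ne {z : ℂ} (hz : z ≠ 0) : sinhQuot z = Complex.sinh z / z := by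
  simp [sinhQuot, dslope_of_ne _ hz, slope_def_field]

lemma differentiable_sinhQuot : Differentiable ℂ sinhQuot := by
  have h : DifferentiableOn ℂ (dslope Complex.sinh 0) univ :=
    (Complex.differentiableOn_dslope univ_mem).2 Complex.differentiable_sinh.differentiableOn
  exact differentiableOn_univ.1 h

lemma Gfun_eq (z : ℂ) : Gfun z = Complex.cosh z / sinhQuot z := by
  by_cases hz : z = 0
  · simp [Gfun, hz, sinhQuot_zero]
  · rw [Gfun, if_neg hz, sinhQuot_of_ne hz, div_div_eq_mul_div, mul_comm]

lemma Afun_eq (n k : ℕ) (z : ℂ) :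
    Afun n k z = Complex.cosh z ^ k / sinhQuot z ^ (n + k) := by
  by_cases hz : z = 0
  · simp [Afun, hz, sinhQuot_zero]
  · rw [Afun, if_neg hz, sinhQuot_of_ne hz, div_pow, div_div_eq_mul_div, mul_comm]

/-- The even factor `e^{-R G(z)} A(z)` of the integrand. -/
noncomputable def evenFactor (R : ℝ) (n k : ℕ) (z : ℂ) : ℂ :=
  Complex.exp (-(R * Gfun z)) * Afun n k z

lemma evenFactor_neg (R : ℝ) (n k : ℕ) (z : ℂ) :
    evenFactor R n k (-z) = evenFactor R n k z := by
  have h : sinhQuot (-z) = sinhQuot z := by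
    by_cases hz : z = 0
    · simp [hz]
    · rw [sinhQuot_of_ne hz, sinhQuot_of_ne (neg_ne_zero.2 hz), Complex.sinh_neg, neg_div_neg_eq]
  simp only [evenFactor, Gfun_eq, Afun_eq, Complex.cosh_neg, h]

lemma differentiableAt_evenFactor (R : ℝ) (n k : ℕ) {z : ℂ} (hz : sinhQuot z ≠ 0) :
    DifferentiableAt ℂ (evenFactor R n k) z := by
  have hs := differentiable_sinhQuot z
  have hc : DifferentiableAt ℂ Complex.cosh z := Complex.differentiable_cosh z
  have h : evenFactor R n k = fun z => Complex.exp (-(R * (Complex.cosh z / sinhQuot z))) *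
      (Complex.cosh z ^ k / sinhQuot z ^ (n + k)) := by
    funext z
    rw [evenFactor, Gfun_eq, Afun_eq]
  rw [h]
  exact ((hc.div hs hz).const_mul _).neg.cexp.mul ((hc.pow k).div (hs.pow _) (pow_ne_zero _ hz))

lemma sqC_sq (w : ℂ) : sqC w ^ 2 = w := by
  simp [sqC]

lemma sqC_zero : sqC 0 = 0 := pow_eq_zero_iff two_ne_zero |>.1 (sqC_sq 0)

lemma continuousAt_sqC_zero : ContinuousAt sqC 0 := by
  have h : ∀ w, ‖sqC w‖ = √‖w‖ := fun w => by
    rw [eq_comm, Real.sqrt_eq_iff_eq_sq (norm_nonneg _) (norm_nonneg _), ← norm_pow, sqC_sq]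
  rw [ContinuousAt, sqC_zero, tendsto_zero_iff_norm_tendsto_zero]
  simp_rw [h]
  have : ContinuousAt (fun w : ℂ => √‖w‖) 0 := by fun_prop
  simpa [ContinuousAt] using this

lemma differentiableAt_sqC {w : ℂ} (hw : w ∈ Complex.slitPlane) : DifferentiableAt ℂ sqC w := by
  unfold sqC
  exact differentiableAt_id.cpow_const hw

section Even

variable {f : ℂ → ℂ}

lemma even_comp_sqC (hf : ∀ z, f (-z) = f z)
    {z w : ℂ} (h : z ^ 2 = w) : f (sqC w) = f z := by
  rcases sq_eq_sq_iff_eq_or_eq_neg.1 ((sqC_sq w).trans h.symm) with h | h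
  · rw [h]
  · rw [h, hf]

lemma differentiableAt_even_comp_sqC_of_ne (hf : ∀ z, f (-z) = f z)
    {w : ℂ} (hw : w ≠ 0)
    (hd : DifferentiableAt ℂ f (sqC w)) : DifferentiableAt ℂ (fun w => f (sqC w)) w := by
  by_cases h : w ∈ Complex.slitPlane
  · exact hd.comp w (differentiableAt_sqC h)
  · have h' : -w ∈ Complex.slitPlane :=
      (Complex.mem_slitPlane_or_neg_mem_slitPlane hw).resolve_left h
    have hr : ∀ v, (Complex.I * sqC (-v)) ^ 2 = v := fun v => by
      rw [mul_pow, sqC_sq, Complex.I_sq]; ring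
    have he : (fun w => f (sqC w)) = fun w => f (Complex.I * sqC (-w)) :=
      funext fun v => even_comp_sqC hf (hr v)
    rw [he]
    have hd' : DifferentiableAt ℂ f (Complex.I * sqC (-w)) := by
      rcases sq_eq_sq_iff_eq_or_eq_neg.1 ((hr w).trans (sqC_sq w).symm) with h | h
      · rwa [h]
      · have : f = fun z => f (-z) := funext fun z => (hf z).symm
        rw [h, this]
        exact DifferentiableAt.comp _ (by simpa using hd) (by fun_prop)
    refine hd'.comp w (DifferentiableAt.const_mul ?_ _)
    exact DifferentiableAt.comp w (differentiableAt_sqC h') (by fun_prop)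

lemma differentiableAt_even_comp_sqC_zero (hf : ∀ z, f (-z) = f z)
    (hd : ∀ᶠ z in 𝓝 0, DifferentiableAt ℂ f z) :
    DifferentiableAt ℂ (fun w => f (sqC w)) 0 := by
  refine (Complex.analyticAt_of_differentiable_on_punctured_nhds_of_continuousAt
    (f := fun w => f (sqC w)) ?_ ?_).differentiableAt
  · have h := continuousAt_sqC_zero
    rw [ContinuousAt, sqC_zero] at h
    filter_upwards [(h.eventually hd).filter_mono nhdsWithin_le_nhds,
      self_mem_nhdsWithin] with w hw hw0
    exact differentiableAt_even_comp_sqC_of_ne hf hw0 hw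
  · have h := hd.self_of_nhds.continuousAt
    rw [← sqC_zero] at h
    exact h.comp (f := sqC) continuousAt_sqC_zero

end Even

lemma differentiableAt_evenFactor_sqC (R : ℝ) (n k : ℕ) {w : ℂ} (hw : sinhQuot (sqC w) ≠ 0) :
    DifferentiableAt ℂ (fun w => evenFactor R n k (sqC w)) w := by
  by_cases h : w = 0
  · subst h
    rw [sqC_zero] at hw
    refine differentiableAt_even_comp_sqC_zero (evenFactor_neg R n k) ?_
    filter_upwards [differentiable_sinhQuot.continuous.continuousAt.eventually_ne hw] with z hz
    exact differentiableAt_evenFactor R n k hz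
  · exact differentiableAt_even_comp_sqC_of_ne (evenFactor_neg R n k) h
      (differentiableAt_evenFactor R n k hw)

lemma sinhQuot_ne_zero {z ζ : ℂ} {s : ℝ} (hs : 0 ≤ s) (h0 : 0 ≤ ζ.im) (h1 : ζ.im < π)
    (hz : z ^ 2 = ζ ^ 2 + s) : sinhQuot z ≠ 0 := by
  by_cases h : z = 0
  · simp [h, sinhQuot_zero]
  rw [sinhQuot_of_ne h]
  refine div_ne_zero (fun hsinh => ?_) h
  have h2 : Complex.sin (z * Complex.I) = 0 := by rw [Complex.sin_mul_I, hsinh, zero_mul]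
  obtain ⟨k, hk⟩ := Complex.sin_eq_zero_iff.1 h2
  have hzk : z = ((-(k * π) : ℝ) : ℂ) * Complex.I := by
    push_cast
    linear_combination (-Complex.I) * hk + z * Complex.I_sq
  have hk0 : k ≠ 0 := by
    rintro rfl
    exact h (by simpa using hzk)
  have hre := congrArg Complex.re hz
  rw [hzk] at hre
  simp [pow_two] at hre
  have hk1 : (1 : ℝ) ≤ (k : ℝ) * k := by
    have : (1 : ℤ) ≤ k * k := by nlinarith [mul_self_pos.2 hk0]
    exact_mod_cast this
  nlinarith [mul_self_nonneg ζ.re, Real.pi_pos, mul_self_nonneg π,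
    mul_le_mul_of_nonneg_right hk1 (mul_self_nonneg π)]

lemma cosh_re (z : ℂ) : (Complex.cosh z).re = Real.cosh z.re * Real.cos z.im := by
  conv_lhs => rw [← Complex.re_add_im z, Complex.cosh_add, Complex.cosh_mul_I, Complex.sinh_mul_I]
  simp [← Complex.ofReal_cosh, ← Complex.ofReal_sinh, ← Complex.ofReal_cos, ← Complex.ofReal_sin]

lemma cosh_im (z : ℂ) : (Complex.cosh z).im = Real.sinh z.re * Real.sin z.im := by
  conv_lhs => rw [← Complex.re_add_im z, Complex.cosh_add, Complex.cosh_mul_I, Complex.sinh_mul_I]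
  simp [← Complex.ofReal_cosh, ← Complex.ofReal_sinh, ← Complex.ofReal_cos, ← Complex.ofReal_sin]

lemma sinh_re (z : ℂ) : (Complex.sinh z).re = Real.sinh z.re * Real.cos z.im := by
  conv_lhs => rw [← Complex.re_add_im z, Complex.sinh_add, Complex.cosh_mul_I, Complex.sinh_mul_I]
  simp [← Complex.ofReal_cosh, ← Complex.ofReal_sinh, ← Complex.ofReal_cos, ← Complex.ofReal_sin]

lemma sinh_im (z : ℂ) : (Complex.sinh z).im = Real.cosh z.re * Real.sin z.im := by
  conv_lhs => rw [← Complex.re_add_im z, Complex.sinh_add, Complex.cosh_mul_I, Complex.sinh_mul_I]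
  simp [← Complex.ofReal_cosh, ← Complex.ofReal_sinh, ← Complex.ofReal_cos, ← Complex.ofReal_sin]

lemma sinh_re_le_norm_sinh {z : ℂ} (hz : 0 ≤ z.re) : Real.sinh z.re ≤ ‖Complex.sinh z‖ := by
  refine (sq_le_sq₀ (Real.sinh_nonneg_iff.2 hz) (norm_nonneg _)).1 ?_
  rw [Complex.sq_norm, Complex.normSq_apply, sinh_re, sinh_im]
  nlinarith [Real.cosh_sq z.re, Real.sin_sq_add_cos_sq z.im, sq_nonneg (Real.sin z.im)]

lemma norm_cosh_le_cosh_re (z : ℂ) : ‖Complex.cosh z‖ ≤ Real.cosh z.re := by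
  refine (sq_le_sq₀ (norm_nonneg _) (Real.cosh_pos _).le).1 ?_
  rw [Complex.sq_norm, Complex.normSq_apply, cosh_re, cosh_im]
  nlinarith [Real.cosh_sq z.re, Real.sin_sq_add_cos_sq z.im, sq_nonneg (Real.sin z.im)]

lemma Gfun_re_nonneg {z : ℂ} (h0 : 0 ≤ z.re) (h : |z.im| ≤ z.re) : 0 ≤ (Gfun z).re := by
  unfold Gfun
  split_ifs with hz
  · simp
  rw [Complex.div_re, ← add_div]
  refine div_nonneg ?_ (Complex.normSq_nonneg _)
  rw [Complex.mul_re, Complex.mul_im, sinh_re, sinh_im, cosh_re, cosh_im]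
  have e : (z.re * (Real.cosh z.re * Real.cos z.im) - z.im * (Real.sinh z.re * Real.sin z.im)) *
        (Real.sinh z.re * Real.cos z.im) +
      (z.re * (Real.sinh z.re * Real.sin z.im) + z.im * (Real.cosh z.re * Real.cos z.im)) *
        (Real.cosh z.re * Real.sin z.im) =
      z.re * (Real.sinh z.re * Real.cosh z.re) + z.im * (Real.sin z.im * Real.cos z.im) := by
    linear_combination (z.re * Real.sinh z.re * Real.cosh z.re) * Real.sin_sq_add_cos_sq z.im +
      z.im * Real.sin z.im * Real.cos z.im * Real.cosh_sq z.re
  rw [e]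
  have h1 : z.re ≤ Real.sinh z.re * Real.cosh z.re :=
    (Real.self_le_sinh_iff.2 h0).trans
      (le_mul_of_one_le_right (Real.sinh_nonneg_iff.2 h0) (Real.one_le_cosh _))
  have h2 : |z.im * (Real.sin z.im * Real.cos z.im)| ≤ |z.im| * |z.im| := by
    rw [abs_mul, abs_mul]
    refine mul_le_mul_of_nonneg_left ?_ (abs_nonneg _)
    calc |Real.sin z.im| * |Real.cos z.im| ≤ |z.im| * 1 :=
          mul_le_mul Real.abs_sin_le_abs (Real.abs_cos_le_one _) (abs_nonneg _) (abs_nonneg _)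
      _ = |z.im| := mul_one _
  have h3 := neg_abs_le (z.im * (Real.sin z.im * Real.cos z.im))
  nlinarith [mul_le_mul_of_nonneg_left h1 h0, abs_nonneg z.im,
    mul_le_mul h h (abs_nonneg _) h0]

lemma cosh_le_two_mul_sinh {a : ℝ} (ha : 1 ≤ a) : Real.cosh a ≤ 2 * Real.sinh a := by
  have h1 : a ≤ Real.sinh a := Real.self_le_sinh_iff.2 (by linarith)
  refine (sq_le_sq₀ (Real.cosh_pos _).le (by linarith)).1 ?_
  nlinarith [Real.cosh_sq a]

lemma exists_pow_le_sinh (p : ℕ) : ∃ C : ℝ, 0 < C ∧ ∀ a : ℝ, 1 ≤ a → a ^ p ≤ C * Real.sinh a := by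
  refine ⟨3 * p.factorial, by positivity, fun a ha => ?_⟩
  have h1 := Real.pow_div_factorial_le_exp a (by linarith) p
  have h2 : Real.exp a = Real.cosh a + Real.sinh a := (Real.cosh_add_sinh a).symm
  have h3 := cosh_le_two_mul_sinh ha
  rw [div_le_iff₀ (by positivity)] at h1
  have : (0 : ℝ) < p.factorial := by positivity
  nlinarith

lemma norm_evenFactor_le {R : ℝ} (hR : 0 < R) {n : ℕ} (hn : 1 ≤ n) (k : ℕ) {z : ℂ}
    (h1 : 1 ≤ z.re) (h : |z.im| ≤ z.re) :
    ‖evenFactor R n k z‖ ≤ 2 ^ k * ‖z‖ ^ (n + k) / Real.sinh z.re := by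
  have hz : z ≠ 0 := by
    rintro rfl
    norm_num at h1
  have hs1 : z.re ≤ Real.sinh z.re := Real.self_le_sinh_iff.2 (by linarith)
  have hs := sinh_re_le_norm_sinh (z := z) (by linarith)
  have hE : ‖Complex.exp (-(R * Gfun z))‖ ≤ 1 := by
    rw [Complex.norm_exp, Real.exp_le_one_iff]
    simp only [Complex.neg_re, Complex.re_ofReal_mul]
    nlinarith [Gfun_re_nonneg (by linarith) h]
  have hpos : 0 < ‖Complex.sinh z‖ := by linarith
  have hc : ‖Complex.cosh z‖ ≤ 2 * ‖Complex.sinh z‖ :=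
    (norm_cosh_le_cosh_re z).trans ((cosh_le_two_mul_sinh h1).trans (by linarith))
  rw [evenFactor, norm_mul, Afun, if_neg hz, norm_div, norm_mul, norm_pow, norm_pow, norm_pow]
  calc _ ≤ 1 * (‖z‖ ^ (n + k) * (2 * ‖Complex.sinh z‖) ^ k / ‖Complex.sinh z‖ ^ (n + k)) := by
        gcongr
    _ = 2 ^ k * ‖z‖ ^ (n + k) / ‖Complex.sinh z‖ ^ n := by
        rw [mul_pow, pow_add ‖Complex.sinh z‖]
        field_simp
    _ ≤ 2 ^ k * ‖z‖ ^ (n + k) / Real.sinh z.re := by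
        refine div_le_div_of_nonneg_left (by positivity) (by linarith) (hs.trans ?_)
        exact le_self_pow₀ (by linarith) (by omega)

lemma exists_norm_evenFactor_sqC_le {R : ℝ} (hR : 0 < R) {n : ℕ} (hn : 1 ≤ n) (k q : ℕ) :
    ∃ C : ℝ, 0 < C ∧ ∀ w : ℂ, 2 ≤ w.re → ‖evenFactor R n k (sqC w)‖ ≤ C / w.re ^ q := by
  obtain ⟨C, hC, h⟩ := exists_pow_le_sinh (n + k + 2 * q)
  refine ⟨2 ^ k * 2 ^ (n + k) * C, by positivity, fun w hw => ?_⟩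
  obtain ⟨z, hz0, hzw⟩ : ∃ z : ℂ, 0 ≤ z.re ∧ z ^ 2 = w := by
    rcases le_total 0 (sqC w).re with h | h
    · exact ⟨_, h, sqC_sq w⟩
    · exact ⟨-sqC w, by simpa using h, by rw [neg_sq, sqC_sq]⟩
  rw [even_comp_sqC (evenFactor_neg R n k) hzw]
  have hre : z.re * z.re - z.im * z.im = w.re := by rw [← hzw, pow_two, Complex.mul_re]
  have h1 : 1 ≤ z.re := by nlinarith [mul_self_nonneg z.im]
  have h2 : |z.im| ≤ z.re := by
    refine abs_le_of_sq_le_sq ?_ hz0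
    nlinarith
  have hnorm : ‖z‖ ≤ 2 * z.re := by
    have := Complex.norm_le_abs_re_add_abs_im z
    rw [abs_of_nonneg hz0] at this
    linarith
  refine (norm_evenFactor_le hR hn k h1 h2).trans ?_
  have hs : 0 < Real.sinh z.re := Real.sinh_pos_iff.2 (by linarith)
  rw [div_le_div_iff₀ hs (by positivity)]
  have hq : w.re ^ q ≤ z.re ^ (2 * q) := by
    rw [pow_mul]
    exact pow_le_pow_left₀ (by linarith) (by nlinarith [mul_self_nonneg z.im]) q
  calc 2 ^ k * ‖z‖ ^ (n + k) * w.re ^ q ≤ 2 ^ k * (2 * z.re) ^ (n + k) * z.re ^ (2 * q) := by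
        gcongr
    _ = 2 ^ k * 2 ^ (n + k) * z.re ^ (n + k + 2 * q) := by ring
    _ ≤ 2 ^ k * 2 ^ (n + k) * (C * Real.sinh z.re) := by
        gcongr
        exact h _ h1
    _ = 2 ^ k * 2 ^ (n + k) * C * Real.sinh z.re := by ring

/-- Horizontal contours in a strip of holomorphy may be exchanged when the function decays
quadratically. -/
lemma integral_eq_integral_add_I_mul {g : ℂ → ℂ} {y C : ℝ} (hy : 0 ≤ y)
    (hd : ∀ ζ : ℂ, ζ.im ∈ Icc 0 y → DifferentiableAt ℂ g ζ)
    (hb : ∀ ζ : ℂ, ζ.im ∈ Icc 0 y → ‖g ζ‖ ≤ C / (1 + ζ.re ^ 2)) :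
    ∫ x : ℝ, g x = ∫ x : ℝ, g (x + Complex.I * y) := by
  have hint : ∀ t ∈ Icc 0 y, Integrable fun x : ℝ => g (x + t * Complex.I) := by
    intro t ht
    have hc : Continuous fun x : ℝ => g (x + t * Complex.I) :=
      continuous_iff_continuousAt.2 fun x =>
        ContinuousAt.comp (f := fun x : ℝ => (x + t * Complex.I : ℂ))
          (hd _ (by simpa using ht)).continuousAt (by fun_prop)
    refine (integrable_inv_one_add_sq.const_mul C).mono' hc.aestronglyMeasurable
      (Eventually.of_forall fun x => ?_)
    simpa [div_eq_mul_inv] using hb (x + t * Complex.I) (by simpa using ht)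
  have hlim : ∀ t ∈ Icc 0 y, Tendsto (fun T : ℝ => ∫ x in -T..T, g (x + t * Complex.I)) atTop
      (𝓝 (∫ x : ℝ, g (x + t * Complex.I))) := fun t ht =>
    intervalIntegral_tendsto_integral (hint t ht) tendsto_neg_atTop_atBot tendsto_id
  have hden : Tendsto (fun T : ℝ => 1 + T ^ 2) atTop atTop :=
    tendsto_atTop_add_const_left _ _ (tendsto_pow_atTop two_ne_zero)
  have hedge : ∀ σ : ℝ, σ ^ 2 = 1 → Tendsto
      (fun T : ℝ => ∫ t in (0 : ℝ)..y, g ((σ * T : ℝ) + t * Complex.I)) atTop (𝓝 0) := by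
    intro σ hσ
    have hz : Tendsto (fun T : ℝ => C / (1 + T ^ 2) * |y - 0|) atTop (𝓝 0) := by
      simpa using (tendsto_const_nhds.div_atTop hden).mul_const (|y - 0|)
    refine squeeze_zero_norm (fun T => ?_) hz
    refine intervalIntegral.norm_integral_le_of_norm_le_const fun t ht => ?_
    rw [uIoc_of_le hy] at ht
    have := hb ((σ * T : ℝ) + t * Complex.I) (by simpa using ⟨ht.1.le, ht.2⟩)
    simpa [mul_pow, hσ] using this
  have hrect : ∀ T : ℝ, (∫ x in -T..T, g (x + (0 : ℝ) * Complex.I)) -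
      (∫ x in -T..T, g (x + y * Complex.I)) +
      Complex.I * (∫ t in (0 : ℝ)..y, g ((1 * T : ℝ) + t * Complex.I)) -
      Complex.I * (∫ t in (0 : ℝ)..y, g ((-1 * T : ℝ) + t * Complex.I)) = 0 := by
    intro T
    have := Complex.integral_boundary_rect_eq_zero_of_differentiableOn g ⟨-T, 0⟩ ⟨T, y⟩
      (fun ζ hζ => (hd ζ (by
        have := hζ.2
        rwa [mem_preimage, uIcc_of_le hy] at this)).differentiableWithinAt)
    simpa only [smul_eq_mul, one_mul, neg_one_mul] using this
  have key := (((hlim 0 ⟨le_rfl, hy⟩).sub (hlim y ⟨hy, le_rfl⟩)).add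
    ((hedge 1 (by norm_num)).const_mul Complex.I)).sub
    ((hedge (-1) (by norm_num)).const_mul Complex.I)
  have h0 := tendsto_nhds_unique (key.congr hrect) tendsto_const_nhds
  simp only [mul_zero, add_zero, sub_zero, Complex.ofReal_zero, zero_mul, sub_eq_zero] at h0
  simpa only [mul_comm Complex.I] using h0

/-- The integrand as a function of the first coordinate and of the sum of the squares of the
other coordinates. -/
noncomputable def integrand (n k₁ k₂ : ℕ) (ω R : ℝ) (ζ : ℂ) (s : ℝ) : ℂ :=
  Complex.exp (Complex.I * R * phiVal ω ζ (ζ ^ 2 + s)) * aVal n k₁ k₂ ζ (ζ ^ 2 + s)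

lemma integrand_eq (n k₁ k₂ : ℕ) (ω R : ℝ) (ζ : ℂ) (s : ℝ) :
    integrand n k₁ k₂ ω R ζ s = Complex.exp (Complex.I * R * (ω * ζ)) *
      evenFactor R n k₁ (sqC (ζ ^ 2 + s)) * ((-1) ^ k₁ * Complex.I ^ k₂ * ζ ^ k₂) := by
  have h : Complex.I * R * phiVal ω ζ (ζ ^ 2 + s) =
      Complex.I * R * (ω * ζ) + -(R * Gfun (sqC (ζ ^ 2 + s))) := by
    rw [phiVal]
    linear_combination (R * Gfun (sqC (ζ ^ 2 + s))) * Complex.I_sq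
  rw [integrand, h, Complex.exp_add, aVal, evenFactor]
  ring

section Strip

variable (n k₁ k₂ : ℕ) (ω R : ℝ) {y : ℝ}

lemma differentiableAt_evenFactor_strip (hy : y < π)
    {ζ : ℂ} {s : ℝ} (hζ : ζ.im ∈ Icc 0 y) (hs : 0 ≤ s) :
    DifferentiableAt ℂ (fun w => evenFactor R n k₁ (sqC w)) (ζ ^ 2 + s) :=
  differentiableAt_evenFactor_sqC R n k₁
    (sinhQuot_ne_zero hs hζ.1 (hζ.2.trans_lt hy) (sqC_sq _))

lemma differentiableAt_integrand (hy : y < π)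
    {ζ : ℂ} {s : ℝ} (hζ : ζ.im ∈ Icc 0 y) (hs : 0 ≤ s) :
    DifferentiableAt ℂ (fun ζ => integrand n k₁ k₂ ω R ζ s) ζ := by
  simp_rw [integrand_eq]
  have h : DifferentiableAt ℂ (fun ζ : ℂ => evenFactor R n k₁ (sqC (ζ ^ 2 + s))) ζ :=
    DifferentiableAt.comp (f := fun ζ : ℂ => ζ ^ 2 + s) ζ
      (differentiableAt_evenFactor_strip n k₁ R hy hζ hs) (by fun_prop)
  fun_prop

lemma continuous_integrand_comp (hy : y < π)
    {X : Type*} [TopologicalSpace X] {u : X → ℂ} {v : X → ℝ}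
    (hu : Continuous u) (hv : Continuous v) (hu' : ∀ x, (u x).im ∈ Icc 0 y)
    (hv' : ∀ x, 0 ≤ v x) : Continuous fun x => integrand n k₁ k₂ ω R (u x) (v x) := by
  simp_rw [integrand_eq]
  have h : Continuous fun x => evenFactor R n k₁ (sqC (u x ^ 2 + v x)) :=
    continuous_iff_continuousAt.2 fun x =>
      ContinuousAt.comp (f := fun x => (u x ^ 2 + v x : ℂ))
        (differentiableAt_evenFactor_strip n k₁ R hy (hu' x) (hv' x)).continuousAt (by fun_prop)
  fun_prop

lemma exists_norm_evenFactor_strip_le (hy : y < π)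
    (hR : 0 < R) (hn : 1 ≤ n) (q : ℕ) :
    ∃ C : ℝ, 0 < C ∧ ∀ (ζ : ℂ) (s : ℝ), ζ.im ∈ Icc 0 y → 0 ≤ s →
      ‖evenFactor R n k₁ (sqC (ζ ^ 2 + s))‖ ≤ C / (1 + ζ.re ^ 2 + s) ^ q := by
  obtain ⟨C₁, hC₁, h₁⟩ := exists_norm_evenFactor_sqC_le hR hn k₁ q
  set B : ℝ := 2 * y ^ 2 + 3 with hB
  have hB1 : 1 ≤ B := by nlinarith [sq_nonneg y]
  have hK : IsCompact ((Icc (-B) B ×ℂ Icc 0 y) ×ˢ Icc 0 B) :=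
    (isCompact_Icc.reProdIm isCompact_Icc).prod isCompact_Icc
  have hcont : ContinuousOn (fun p : ℂ × ℝ => evenFactor R n k₁ (sqC (p.1 ^ 2 + p.2)))
      ((Icc (-B) B ×ℂ Icc 0 y) ×ˢ Icc 0 B) := fun p hp =>
    (ContinuousAt.comp (f := fun p : ℂ × ℝ => (p.1 ^ 2 + p.2 : ℂ))
      (differentiableAt_evenFactor_strip n k₁ R hy hp.1.2 hp.2.1).continuousAt
      (by fun_prop)).continuousWithinAt
  obtain ⟨C₂, h₂⟩ := hK.exists_bound_of_continuousOn hcont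
  refine ⟨C₁ * 2 ^ q + |C₂| * (1 + B) ^ q, by positivity, fun ζ s hζ hs => ?_⟩
  have hu : 0 ≤ ζ.re ^ 2 + s := by positivity
  have hu1 : 0 < 1 + ζ.re ^ 2 + s := by linarith
  rw [le_div_iff₀ (by positivity)]
  rcases le_total (ζ.re ^ 2 + s) B with h | h
  · have hmem : (ζ, s) ∈ (Icc (-B) B ×ℂ Icc 0 y) ×ˢ Icc 0 B := by
      refine ⟨⟨abs_le.1 (abs_le_of_sq_le_sq ?_ (by linarith)), hζ⟩, hs, ?_⟩
      · nlinarith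
      · nlinarith [sq_nonneg ζ.re]
    calc _ ≤ |C₂| * (1 + B) ^ q := by
          refine mul_le_mul ((h₂ _ hmem).trans (le_abs_self _))
            (pow_le_pow_left₀ hu1.le (by linarith) q) (by positivity) (abs_nonneg _)
      _ ≤ _ := le_add_of_nonneg_left (by positivity)
  · have hre : (ζ ^ 2 + s).re = ζ.re ^ 2 + s - ζ.im ^ 2 := by
      simp [pow_two]
      ring
    have him : ζ.im ^ 2 ≤ y ^ 2 := pow_le_pow_left₀ hζ.1 hζ.2 2
    have hw : 1 + ζ.re ^ 2 + s ≤ 2 * (ζ ^ 2 + s).re := by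
      rw [hre]
      linarith
    have hw2 : 2 ≤ (ζ ^ 2 + s).re := by linarith
    calc _ ≤ C₁ / (ζ ^ 2 + s).re ^ q * (2 * (ζ ^ 2 + s).re) ^ q := by
          gcongr
          exact h₁ _ hw2
      _ = C₁ * 2 ^ q := by
          have : (ζ ^ 2 + s).re ≠ 0 := by linarith
          rw [mul_pow]
          field_simp
      _ ≤ _ := le_add_of_nonneg_right (by positivity)

lemma exists_norm_integrand_le (hy : y < π)
    (hω : 0 ≤ ω) (hR : 0 < R) (hn : 1 ≤ n) (q : ℕ) :
    ∃ C : ℝ, 0 < C ∧ ∀ (ζ : ℂ) (s : ℝ), ζ.im ∈ Icc 0 y → 0 ≤ s →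
      ‖integrand n k₁ k₂ ω R ζ s‖ ≤ C / (1 + ζ.re ^ 2 + s) ^ q := by
  obtain ⟨C, hC, h⟩ := exists_norm_evenFactor_strip_le n k₁ R hy hR hn (q + k₂)
  refine ⟨C * (2 + y ^ 2) ^ k₂, by positivity, fun ζ s hζ hs => ?_⟩
  have hu1 : 1 ≤ 1 + ζ.re ^ 2 + s := by nlinarith [sq_nonneg ζ.re]
  have hE : ‖Complex.exp (Complex.I * R * (ω * ζ))‖ ≤ 1 := by
    rw [Complex.norm_exp, Real.exp_le_one_iff]
    have : (Complex.I * R * (ω * ζ)).re = -(R * ω * ζ.im) := by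
      simp
      ring
    rw [this, neg_nonpos]
    exact mul_nonneg (mul_nonneg hR.le hω) hζ.1
  have him : ζ.im ^ 2 ≤ y ^ 2 := pow_le_pow_left₀ hζ.1 hζ.2 2
  have hζn : ‖ζ‖ ≤ (2 + y ^ 2) * (1 + ζ.re ^ 2 + s) := by
    have : ‖ζ‖ ^ 2 = ζ.re ^ 2 + ζ.im ^ 2 := by
      rw [Complex.sq_norm, Complex.normSq_apply]
      ring
    nlinarith [sq_nonneg (‖ζ‖ - 1), sq_nonneg y, sq_nonneg ζ.re,
      mul_nonneg (sq_nonneg y) (add_nonneg (sq_nonneg ζ.re) hs)]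
  rw [integrand_eq]
  simp only [norm_mul, norm_pow, norm_neg, norm_one, one_pow, Complex.norm_I, one_mul]
  calc _ ≤ 1 * (C / (1 + ζ.re ^ 2 + s) ^ (q + k₂)) *
        ((2 + y ^ 2) * (1 + ζ.re ^ 2 + s)) ^ k₂ := by
        gcongr
        exact h ζ s hζ hs
    _ = _ := by
        rw [mul_pow, pow_add]
        field_simp

lemma integrable_integrand (hy : y < π)
    (hω : 0 ≤ ω) (hR : 0 < R) (hn : 1 ≤ n) (m : ℕ) {t : ℝ}
    (ht : t ∈ Icc 0 y) :
    Integrable fun p : ℝ × (Fin m → ℝ) =>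
      integrand n k₁ k₂ ω R (p.1 + Complex.I * t) (∑ j, p.2 j ^ 2) := by
  obtain ⟨C, hC, h⟩ := exists_norm_integrand_le n k₁ k₂ ω R hy hω hR hn (m + 1)
  have hcont := continuous_integrand_comp n k₁ k₂ ω R hy
    (u := fun p : ℝ × (Fin m → ℝ) => (p.1 + Complex.I * t : ℂ)) (v := fun p => ∑ j, p.2 j ^ 2)
    (by fun_prop) (by fun_prop) (fun p => by simpa using ht) (fun p => by positivity)
  have : (volume : Measure (ℝ × (Fin m → ℝ))).IsAddHaarMeasure :=
    inferInstanceAs ((volume : Measure ℝ).prod (volume : Measure (Fin m → ℝ))).IsAddHaarMeasure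
  have hI : Integrable fun p : ℝ × (Fin m → ℝ) =>
      (1 + ‖p‖ ^ 2) ^ (-(2 * (m + 1 : ℕ) : ℝ) / 2) :=
    integrable_rpow_neg_one_add_norm_sq (by
      simp
      linarith [(Nat.cast_nonneg m : (0 : ℝ) ≤ m)])
  refine (hI.const_mul C).mono' hcont.aestronglyMeasurable (Eventually.of_forall fun p => ?_)
  refine (h _ _ (by simpa using ht) (by positivity)).trans ?_
  have hn : ‖p‖ ^ 2 ≤ p.1 ^ 2 + ∑ j, p.2 j ^ 2 := by
    have hnn : 0 ≤ p.1 ^ 2 + ∑ j, p.2 j ^ 2 := by positivity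
    refine (Real.le_sqrt (norm_nonneg p) hnn).1 ?_
    refine max_le ?_ ((pi_norm_le_iff_of_nonneg (Real.sqrt_nonneg _)).2 fun i => ?_)
    · exact Real.abs_le_sqrt (le_add_of_nonneg_right (by positivity))
    · refine Real.abs_le_sqrt (le_add_of_nonneg_of_le (sq_nonneg _) ?_)
      exact Finset.single_le_sum (f := fun j => p.2 j ^ 2) (fun j _ => sq_nonneg _)
        (Finset.mem_univ i)
  rw [show -(2 * (m + 1 : ℕ) : ℝ) / 2 = -((m + 1 : ℕ) : ℝ) by ring,
    Real.rpow_neg (by positivity), Real.rpow_natCast, div_eq_mul_inv]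
  simp only [Complex.add_re, Complex.ofReal_re, Complex.re_mul_ofReal, Complex.I_re, zero_mul,
    add_zero]
  rw [add_assoc]
  gcongr

lemma integral_integrand_eq (hy : y < π)
    (hy0 : 0 ≤ y) (hω : 0 ≤ ω) (hR : 0 < R) (hn : 1 ≤ n) (m : ℕ) :
    ∫ p : ℝ × (Fin m → ℝ), integrand n k₁ k₂ ω R p.1 (∑ j, p.2 j ^ 2) =
      ∫ p : ℝ × (Fin m → ℝ), integrand n k₁ k₂ ω R (p.1 + Complex.I * y) (∑ j, p.2 j ^ 2) := by
  have h0 := integrable_integrand n k₁ k₂ ω R hy hω hR hn m ⟨le_rfl, hy0⟩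
  have h1 := integrable_integrand n k₁ k₂ ω R hy hω hR hn m ⟨hy0, le_rfl⟩
  simp only [Complex.ofReal_zero, mul_zero, add_zero] at h0
  rw [Measure.volume_eq_prod] at h0 h1 ⊢
  rw [integral_prod_symm _ h0, integral_prod_symm _ h1]
  obtain ⟨C, hC, h⟩ := exists_norm_integrand_le n k₁ k₂ ω R hy hω hR hn 1
  refine integral_congr_ae (Eventually.of_forall fun v => ?_)
  have hv : 0 ≤ ∑ j, v j ^ 2 := by positivity
  refine integral_eq_integral_add_I_mul (C := C)
    (g := fun ζ => integrand n k₁ k₂ ω R ζ (∑ j, v j ^ 2)) hy0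
    (fun ζ hζ => differentiableAt_integrand n k₁ k₂ ω R hy hζ hv) fun ζ hζ => ?_
  refine (h ζ _ hζ hv).trans ?_
  rw [pow_one]
  exact div_le_div_of_nonneg_left hC.le (by positivity) (le_add_of_nonneg_right hv)

end Strip

lemma integral_fin_succ {m : ℕ} (F : ℝ × (Fin m → ℝ) → ℂ) :
    ∫ v : Fin (m + 1) → ℝ, F (v 0, fun j => v j.succ) = ∫ p, F p :=
  (volume_preserving_piFinSuccAbove (fun _ : Fin (m + 1) => ℝ) 0).integral_comp' F

/-- Shifting the contour of integration by iy·u₁, 0 ≤ y < π, does not change the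
integral ∫_{ℝ^m} e^{iRφ_ω(λ)} a_{k₁,k₂}(λ) dλ. -/
theorem contour_shift (n m k₁ k₂ : ℕ) (hn : 1 ≤ n) (hm : 0 < m)
    (ω R : ℝ) (hω : 0 ≤ ω) (hR : 0 < R) (y : ℝ) (hy : y ∈ Set.Ico 0 π) :
    (∫ lam : Fin m → ℝ,
        Complex.exp (Complex.I * (R : ℂ) *
            phiVal ω ((lam ⟨0, hm⟩ : ℝ) : ℂ) (∑ j, ((lam j : ℝ) : ℂ) ^ 2)) *
          aVal n k₁ k₂ ((lam ⟨0, hm⟩ : ℝ) : ℂ) (∑ j, ((lam j : ℝ) : ℂ) ^ 2))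
      = ∫ lam : Fin m → ℝ,
        Complex.exp (Complex.I * (R : ℂ) *
            phiVal ω (((lam ⟨0, hm⟩ : ℝ) : ℂ) + Complex.I * (y : ℂ))
              (∑ j, (((lam j : ℝ) : ℂ) +
                (if j = (⟨0, hm⟩ : Fin m) then Complex.I * (y : ℂ) else 0)) ^ 2)) *
          aVal n k₁ k₂ (((lam ⟨0, hm⟩ : ℝ) : ℂ) + Complex.I * (y : ℂ))
            (∑ j, (((lam j : ℝ) : ℂ) +
              (if j = (⟨0, hm⟩ : Fin m) then Complex.I * (y : ℂ) else 0)) ^ 2) := by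
  obtain ⟨m, rfl⟩ : ∃ p, m = p + 1 := ⟨m - 1, by omega⟩
  have h := integral_integrand_eq n k₁ k₂ ω R hy.2 hy.1 hω hR hn m
  rw [← integral_fin_succ, ← integral_fin_succ] at h
  simpa [integrand, Fin.sum_univ_succ] using h
end

section
/- Let n ≥ 1 and k₁, k₂ ≥ 0 be integers, and define a_{k₁,k₂}(z) = (−1)^{k₁} i^{k₂} z^{n+k₁+k₂} cosh(z)^{k₁} / sinh(z)^{n+k₁} for z ∈ ℂ with sinh z ≠ 0. Then there exists a constant C′ > 0 such that for all R ≥ 0 and T ≥ 0, |∫_ℝ exp(iT(λ + 3πi/2) − R(λ + 3πi/2)·coth(λ + 3πi/2)) · a_{k₁,k₂}(λ + 3πi/2) dλ| ≤ C′ e^{−3πT/2}. -/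
open Real Complex MeasureTheory

/-- The complex hyperbolic cotangent coth z = cosh z / sinh z. -/
noncomputable def cothC (z : ℂ) : ℂ := Complex.cosh z / Complex.sinh z

/-- a_{k₁,k₂}(z) = (−1)^{k₁} i^{k₂} z^{n+k₁+k₂} cosh(z)^{k₁} / sinh(z)^{n+k₁}. -/
noncomputable def aC (n k₁ k₂ : ℕ) (z : ℂ) : ℂ :=
  (-1 : ℂ) ^ k₁ * Complex.I ^ k₂ * z ^ (n + k₁ + k₂) *
    Complex.cosh z ^ k₁ / Complex.sinh z ^ (n + k₁)

lemma cosh_add_three_pi_div_two (x : ℝ) :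
    Complex.cosh ((x : ℂ) + 3 * (π : ℂ) * Complex.I / 2) = -Complex.I * (Real.sinh x : ℂ) := by
  have h : (x : ℂ) + 3 * (π : ℂ) * Complex.I / 2
      = ((x : ℂ) - π / 2 * Complex.I) + 2 * π * Complex.I := by ring
  rw [h, Complex.cosh_add, Complex.cosh_sub, Complex.sinh_sub]
  simp [Complex.cosh_mul_I, Complex.sinh_mul_I]
  ring

lemma sinh_add_three_pi_div_two (x : ℝ) :
    Complex.sinh ((x : ℂ) + 3 * (π : ℂ) * Complex.I / 2) = -Complex.I * (Real.cosh x : ℂ) := by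
  have h : (x : ℂ) + 3 * (π : ℂ) * Complex.I / 2
      = ((x : ℂ) - π / 2 * Complex.I) + 2 * π * Complex.I := by ring
  rw [h, Complex.sinh_add, Complex.cosh_sub, Complex.sinh_sub]
  simp [Complex.cosh_mul_I, Complex.sinh_mul_I]
  ring

lemma cothC_add_three_pi_div_two (x : ℝ) :
    cothC ((x : ℂ) + 3 * (π : ℂ) * Complex.I / 2) = (Real.tanh x : ℂ) := by
  rw [cothC, cosh_add_three_pi_div_two, sinh_add_three_pi_div_two,
    mul_div_mul_left _ _ (neg_ne_zero.mpr Complex.I_ne_zero), Real.tanh_eq_sinh_div_cosh,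
    Complex.ofReal_div]

lemma mul_tanh_nonneg (x : ℝ) : 0 ≤ x * Real.tanh x := by
  rw [Real.tanh_eq_sinh_div_cosh, ← mul_div_assoc]
  refine div_nonneg ?_ (Real.cosh_pos x).le
  rcases le_total 0 x with hx | hx
  · exact mul_nonneg hx (Real.sinh_nonneg_iff.mpr hx)
  · exact mul_nonneg_of_nonpos_of_nonpos hx (Real.sinh_nonpos_iff.mpr hx)

lemma norm_exp_phase_le {R : ℝ} (hR : 0 ≤ R) (T x : ℝ) :
    ‖Complex.exp (Complex.I * (T : ℂ) * ((x : ℂ) + 3 * (π : ℂ) * Complex.I / 2)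
        - (R : ℂ) * ((x : ℂ) + 3 * (π : ℂ) * Complex.I / 2) *
            cothC ((x : ℂ) + 3 * (π : ℂ) * Complex.I / 2))‖
      ≤ Real.exp (-(3 * π * T) / 2) := by
  have h : Complex.I * (T : ℂ) * ((x : ℂ) + 3 * (π : ℂ) * Complex.I / 2)
        - (R : ℂ) * ((x : ℂ) + 3 * (π : ℂ) * Complex.I / 2) * (Real.tanh x : ℂ)
      = ((-(3 * π * T) / 2 - R * (x * Real.tanh x) : ℝ) : ℂ)
        + ((T * x - R * (3 * π / 2) * Real.tanh x : ℝ) : ℂ) * Complex.I := by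
    push_cast
    linear_combination (3 * (π : ℂ) * T / 2) * Complex.I_sq
  rw [cothC_add_three_pi_div_two, h, Complex.norm_exp, Complex.add_re, Complex.ofReal_re,
    Complex.re_ofReal_mul, Complex.I_re, mul_zero, add_zero]
  exact Real.exp_le_exp.mpr (sub_le_self _ (mul_nonneg hR (mul_tanh_nonneg x)))

lemma abs_sinh_le_cosh (x : ℝ) : |Real.sinh x| ≤ Real.cosh x := by
  refine abs_le_of_sq_le_sq ?_ (Real.cosh_pos x).le
  rw [Real.cosh_sq]
  linarith

lemma exp_abs_le_two_mul_cosh (x : ℝ) : Real.exp |x| ≤ 2 * Real.cosh x := by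
  rw [← Real.cosh_abs x, Real.cosh_eq]
  linarith [Real.exp_pos (-|x|)]

lemma pow_le_inv_one_add_sq_mul_cosh (m : ℕ) (x : ℝ) :
    (|x| + 5) ^ m ≤
      2 * ((m + 2).factorial * Real.exp 5) * (1 + x ^ 2)⁻¹ * Real.cosh x := by
  have h1 : (|x| + 5) ^ (m + 2) ≤ (m + 2).factorial * Real.exp (|x| + 5) := by
    have := Real.pow_div_factorial_le_exp (|x| + 5) (by positivity) (m + 2)
    rwa [div_le_iff₀' (by positivity)] at this
  have h2 : 1 + x ^ 2 ≤ (|x| + 5) ^ 2 := by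
    nlinarith [sq_abs x, abs_nonneg x]
  have h3 : (|x| + 5) ^ m * (1 + x ^ 2) ≤
      2 * ((m + 2).factorial * Real.exp 5) * Real.cosh x :=
    calc (|x| + 5) ^ m * (1 + x ^ 2) ≤ (|x| + 5) ^ m * (|x| + 5) ^ 2 := by gcongr
      _ = (|x| + 5) ^ (m + 2) := (pow_add _ _ _).symm
      _ ≤ (m + 2).factorial * Real.exp (|x| + 5) := h1
      _ = (m + 2).factorial * Real.exp 5 * Real.exp |x| := by rw [Real.exp_add]; ring
      _ ≤ (m + 2).factorial * Real.exp 5 * (2 * Real.cosh x) := by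
        gcongr
        exact exp_abs_le_two_mul_cosh x
      _ = _ := by ring
  rw [mul_right_comm, ← div_eq_mul_inv, le_div_iff₀ (by positivity)]
  exact h3

lemma norm_add_three_pi_div_two_le (x : ℝ) :
    ‖(x : ℂ) + 3 * (π : ℂ) * Complex.I / 2‖ ≤ |x| + 5 := by
  refine (norm_add_le _ _).trans ?_
  have h : ‖3 * (π : ℂ) * Complex.I / 2‖ = 3 * π / 2 := by
    simp [abs_of_pos Real.pi_pos]
  rw [h, Complex.norm_real, Real.norm_eq_abs]
  linarith [Real.pi_lt_d2]

lemma norm_aC_le {n : ℕ} (hn : 1 ≤ n) (k₁ k₂ : ℕ) (x : ℝ) :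
    ‖aC n k₁ k₂ ((x : ℂ) + 3 * (π : ℂ) * Complex.I / 2)‖ ≤
      2 * ((n + k₁ + k₂ + 2).factorial * Real.exp 5) * (1 + x ^ 2)⁻¹ := by
  have hc := Real.cosh_pos x
  have h1 : Real.cosh x ^ (1 + k₁) ≤ Real.cosh x ^ (n + k₁) :=
    pow_le_pow_right₀ (Real.one_le_cosh x) (by lia)
  rw [aC, cosh_add_three_pi_div_two, sinh_add_three_pi_div_two]
  simp only [norm_div, norm_mul, norm_pow, norm_neg, norm_one, Complex.norm_I, one_pow, one_mul,
    Complex.norm_real, Real.norm_eq_abs, abs_of_pos hc]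
  rw [div_le_iff₀ (by positivity)]
  calc ‖(x : ℂ) + 3 * (π : ℂ) * Complex.I / 2‖ ^ (n + k₁ + k₂) * |Real.sinh x| ^ k₁
      ≤ (|x| + 5) ^ (n + k₁ + k₂) * Real.cosh x ^ k₁ := by
        gcongr
        · exact norm_add_three_pi_div_two_le x
        · exact abs_sinh_le_cosh x
    _ ≤ 2 * ((n + k₁ + k₂ + 2).factorial * Real.exp 5) * (1 + x ^ 2)⁻¹ * Real.cosh x *
          Real.cosh x ^ k₁ := by
        gcongr
        exact pow_le_inv_one_add_sq_mul_cosh _ x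
    _ = 2 * ((n + k₁ + k₂ + 2).factorial * Real.exp 5) * (1 + x ^ 2)⁻¹ *
          Real.cosh x ^ (1 + k₁) := by ring
    _ ≤ _ := by gcongr

/-- The integral over the line ℝ + 3πi/2 is bounded by a constant times e^{−3πT/2}. -/
theorem line_integral_bound (n k₁ k₂ : ℕ) (hn : 1 ≤ n) :
    ∃ C' : ℝ, 0 < C' ∧ ∀ R T : ℝ, 0 ≤ R → 0 ≤ T →
      ‖∫ lam : ℝ,
          Complex.exp (Complex.I * (T : ℂ) * ((lam : ℂ) + 3 * (π : ℂ) * Complex.I / 2)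
              - (R : ℂ) * ((lam : ℂ) + 3 * (π : ℂ) * Complex.I / 2) *
                  cothC ((lam : ℂ) + 3 * (π : ℂ) * Complex.I / 2)) *
            aC n k₁ k₂ ((lam : ℂ) + 3 * (π : ℂ) * Complex.I / 2)‖
        ≤ C' * Real.exp (-(3 * π * T) / 2) := by
  set K : ℝ := 2 * ((n + k₁ + k₂ + 2).factorial * Real.exp 5)
  refine ⟨K * π, by positivity, fun R T hR _ => ?_⟩
  have hint : Integrable fun x : ℝ => Real.exp (-(3 * π * T) / 2) * (K * (1 + x ^ 2)⁻¹) :=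
    (integrable_inv_one_add_sq.const_mul K).const_mul _
  refine (norm_integral_le_of_norm_le hint (ae_of_all _ fun x => ?_)).trans_eq ?_
  · rw [norm_mul]
    exact mul_le_mul (norm_exp_phase_le hR T x) (norm_aC_le hn k₁ k₂ x) (norm_nonneg _)
      (Real.exp_pos _).le
  · rw [integral_const_mul, integral_const_mul, integral_univ_inv_one_add_sq, mul_comm]
end

section
/- Define r(λ) = 1 + 1/λ − π(1 + λ)cot(πλ) for λ ∈ ℂ ∖ ℤ, extended by r(0) = 0 (r is holomorphic on ℂ ∖ ℤ*), and q(δ, ζ) = cosh(ζ) + (δ/2)·r(−δe^{−ζ}). Then: (i) q is holomorphic on {(δ, ζ) ∈ ℂ × ℂ : δe^{−ζ} ∉ ℤ*}; (ii) there exist δ₁ ∈ (0, 1) and η₁ > 0 such that for every δ in the open complex ball B(0, δ₁) there is a unique σ_δ ∈ B(0, η₁) with ∂_ζ q(δ, σ_δ) = 0; (iii) the map δ ↦ σ_δ is holomorphic on B(0, δ₁) and real-valued on (−δ₁, δ₁); (iv) there is a constant K > 0 such that |σ_δ| ≤ K|δ|² and |q(δ, σ_δ) − 1| ≤ K|δ|²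 for all δ ∈ B(0, δ₁/2). -/
open Real Complex

/-- r(λ) = 1 + 1/λ − π(1 + λ)cot(πλ) for λ ∉ ℤ, extended by r(0) = 0. -/
noncomputable def rfun (z : ℂ) : ℂ :=
  if z = 0 then 0
  else 1 + 1 / z - (π : ℂ) * (1 + z) * (Complex.cos ((π : ℂ) * z) / Complex.sin ((π : ℂ) * z))

/-- q(δ, ζ) = cosh(ζ) + (δ/2)·r(−δe^{−ζ}). -/
noncomputable def qfun (δ ζ : ℂ) : ℂ :=
  Complex.cosh ζ + δ / 2 * rfun (-δ * Complex.exp (-ζ))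

open Filter Topology ComplexConjugate

theorem entire_dslope {f : ℂ → ℂ} (hf : Differentiable ℂ f) (c : ℂ) :
    Differentiable ℂ (dslope f c) := by
  rw [← differentiableOn_univ] at hf ⊢
  exact (Complex.differentiableOn_dslope univ_mem).2 hf

theorem deriv_zero_of_even {f : ℂ → ℂ} (hf : ∀ z, f (-z) = f z) : deriv f 0 = 0 := by
  have h := deriv_comp_neg f 0
  simp only [hf, neg_zero] at h
  exact self_eq_neg.1 h

/-- `sin (πz) / z`, extended to an entire function. -/
noncomputable def sinQuot : ℂ → ℂ := dslope (fun z => Complex.sin (π * z)) 0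

theorem differentiable_sinQuot : Differentiable ℂ sinQuot :=
  entire_dslope (by fun_prop) 0

theorem mul_sinQuot (z : ℂ) : z * sinQuot z = Complex.sin (π * z) := by
  have h := sub_smul_dslope (fun z => Complex.sin (π * z)) 0 z
  simpa [sinQuot] using h

theorem sinQuot_zero : sinQuot 0 = π := by
  have h : HasDerivAt (fun z : ℂ => Complex.sin (π * z)) (Complex.cos (π * 0) * (π * 1)) 0 :=
    ((hasDerivAt_id (0 : ℂ)).const_mul (π : ℂ)).csin
  rw [sinQuot, dslope_same, h.deriv]
  simp

theorem sinQuot_neg (z : ℂ) : sinQuot (-z) = sinQuot z := by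
  rcases eq_or_ne z 0 with rfl | hz
  · simp
  · apply mul_left_cancel₀ (neg_ne_zero.2 hz)
    rw [mul_sinQuot, neg_mul z, mul_sinQuot, mul_neg, Complex.sin_neg]

theorem sinQuot_ne_zero {z : ℂ} (hz : ∀ k : ℤ, k ≠ 0 → z ≠ k) : sinQuot z ≠ 0 := by
  intro h
  have hpi : (π : ℂ) ≠ 0 := by exact_mod_cast Real.pi_ne_zero
  have h0 := mul_sinQuot z
  rw [h, mul_zero, eq_comm, Complex.sin_eq_zero_iff] at h0
  obtain ⟨k, hk⟩ := h0
  have hzk : z = k := by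
    apply mul_left_cancel₀ hpi
    rw [hk, mul_comm]
  rcases eq_or_ne k 0 with rfl | hk0
  · rw [hzk, Int.cast_zero, sinQuot_zero] at h
    exact hpi h
  · exact hz k hk0 hzk

/-- `(sin (πz) / z - π cos (πz)) / z`, extended to an entire function. -/
noncomputable def cotRemainder : ℂ → ℂ := dslope (fun z => sinQuot z - π * Complex.cos (π * z)) 0

theorem differentiable_cotRemainder : Differentiable ℂ cotRemainder :=
  entire_dslope (by have := differentiable_sinQuot; fun_prop) 0

theorem mul_cotRemainder (z : ℂ) :
    z * cotRemainder z = sinQuot z - π * Complex.cos (π * z) := by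
  have h := sub_smul_dslope (fun z => sinQuot z - π * Complex.cos (π * z)) 0 z
  simpa [cotRemainder, sinQuot_zero] using h

theorem cotRemainder_zero : cotRemainder 0 = 0 := by
  rw [cotRemainder, dslope_same]
  exact deriv_zero_of_even fun z => by simp [sinQuot_neg]

theorem rfun_eq {z : ℂ} (hz : ∀ k : ℤ, k ≠ 0 → z ≠ k) :
    rfun z = (1 + z) * cotRemainder z / sinQuot z := by
  rcases eq_or_ne z 0 with rfl | h0
  · simp [rfun, cotRemainder_zero]
  · have hs := sinQuot_ne_zero hz
    have hr := mul_cotRemainder z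
    rw [rfun, if_neg h0, ← mul_sinQuot]
    generalize Complex.cos (π * z) = c at hr ⊢
    field_simp
    linear_combination (-(1 + z)) * hr

theorem isOpen_ne_nonzero_int : IsOpen {z : ℂ | ∀ k : ℤ, k ≠ 0 → z ≠ k} := by
  have h : IsClosed ((fun k : ℤ => (k : ℂ)) '' {k | k ≠ 0}) :=
    Complex.isClosedEmbedding_intCast.isClosedMap _ (isClosed_discrete _)
  convert h.isOpen_compl using 1
  ext z
  simp only [Set.mem_ofPred_eq, Set.mem_compl_iff, Set.mem_image, not_exists, not_and]
  exact forall₂_congr fun k _ => ne_comm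

theorem differentiableOn_rfun :
    DifferentiableOn ℂ rfun {z : ℂ | ∀ k : ℤ, k ≠ 0 → z ≠ k} := by
  have h : DifferentiableOn ℂ (fun z => (1 + z) * cotRemainder z / sinQuot z)
      {z : ℂ | ∀ k : ℤ, k ≠ 0 → z ≠ k} := by
    have h₁ := differentiable_cotRemainder
    have h₂ := differentiable_sinQuot
    exact DifferentiableOn.div (by fun_prop) (by fun_prop) fun z hz => sinQuot_ne_zero hz
  exact h.congr fun z hz => rfun_eq hz

theorem differentiableAt_rfun {z : ℂ} (hz : ∀ k : ℤ, k ≠ 0 → z ≠ k) :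
    DifferentiableAt ℂ rfun z :=
  differentiableOn_rfun.differentiableAt (isOpen_ne_nonzero_int.mem_nhds hz)

theorem analyticAt_rfun_zero : AnalyticAt ℂ rfun 0 :=
  differentiableOn_rfun.analyticAt <| isOpen_ne_nonzero_int.mem_nhds fun k hk => by
    simpa [eq_comm] using hk

theorem rfun_zero : rfun 0 = 0 := if_pos rfl

theorem rfun_conj (z : ℂ) : rfun (conj z) = conj (rfun z) := by
  rcases eq_or_ne z 0 with rfl | h0
  · simp [rfun]
  · simp [rfun, h0, ← Complex.cos_conj, ← Complex.sin_conj]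

theorem qfun_conj (δ ζ : ℂ) : qfun (conj δ) (conj ζ) = conj (qfun δ ζ) := by
  have h : conj (2 : ℂ) = 2 := Complex.conj_ofNat 2
  simp [qfun, h, ← Complex.cosh_conj, ← Complex.exp_conj, ← rfun_conj]

theorem deriv_qfun_conj (δ ζ : ℂ) :
    deriv (qfun (conj δ)) (conj ζ) = conj (deriv (qfun δ) ζ) := by
  have h : qfun (conj δ) = conj ∘ qfun δ ∘ conj := by
    ext z
    simpa using qfun_conj δ (conj z)
  rw [h, deriv_conj_conj]
  simp

theorem differentiableOn_qfun :
    DifferentiableOn ℂ (fun p : ℂ × ℂ => qfun p.1 p.2)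
      {p : ℂ × ℂ | ∀ k : ℤ, k ≠ 0 → p.1 * Complex.exp (-p.2) ≠ (k : ℂ)} := by
  intro p hp
  apply DifferentiableAt.differentiableWithinAt
  have hr : DifferentiableAt ℂ rfun (-p.1 * Complex.exp (-p.2)) := by
    refine differentiableAt_rfun fun k hk h => hp (-k) (neg_ne_zero.2 hk) ?_
    push_cast
    rw [← h]
    ring
  have hc : DifferentiableAt ℂ (fun p : ℂ × ℂ => rfun (-p.1 * Complex.exp (-p.2))) p :=
    hr.comp p (f := fun p : ℂ × ℂ => -p.1 * Complex.exp (-p.2)) (by fun_prop)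
  unfold qfun
  fun_prop

/-- The coefficient of `δ²` in `∂_ζ q(δ, ζ) - sinh ζ`. -/
noncomputable def qderivRemainder (p : ℂ × ℂ) : ℂ :=
  deriv rfun (-p.1 * Complex.exp (-p.2)) * Complex.exp (-p.2) / 2

/-- The closed form of `∂_ζ q(δ, ζ)`. -/
noncomputable def qderiv (p : ℂ × ℂ) : ℂ :=
  Complex.sinh p.2 + p.1 ^ 2 * qderivRemainder p

theorem tendsto_neg_mul_exp :
    Tendsto (fun p : ℂ × ℂ => -p.1 * Complex.exp (-p.2)) (𝓝 0) (𝓝 0) := by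
  have h : Continuous fun p : ℂ × ℂ => -p.1 * Complex.exp (-p.2) := by fun_prop
  simpa using h.tendsto 0

theorem eventually_deriv_qfun :
    ∀ᶠ p : ℂ × ℂ in 𝓝 0, deriv (qfun p.1) p.2 = qderiv p := by
  filter_upwards [tendsto_neg_mul_exp.eventually analyticAt_rfun_zero.eventually_analyticAt]
    with p hp
  have he : HasDerivAt (fun ζ => -p.1 * Complex.exp (-ζ))
      (-p.1 * (Complex.exp (-p.2) * -1)) p.2 :=
    ((hasDerivAt_neg p.2).cexp).const_mul _
  have hq := (Complex.hasDerivAt_cosh p.2).add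
    ((hp.differentiableAt.hasDerivAt.comp p.2 he).const_mul (p.1 / 2))
  have hq' : HasDerivAt (qfun p.1) _ p.2 := hq
  rw [hq'.deriv, qderiv, qderivRemainder]
  ring

theorem analyticAt_qderivRemainder : AnalyticAt ℂ qderivRemainder 0 := by
  have h₃ : AnalyticAt ℂ (fun p : ℂ × ℂ => Complex.exp (-p.2)) 0 := analyticAt_snd.neg.cexp
  have h₁ : AnalyticAt ℂ (fun p : ℂ × ℂ => -p.1 * Complex.exp (-p.2)) 0 :=
    analyticAt_fst.neg.mul h₃
  have h₂ : AnalyticAt ℂ (fun p : ℂ × ℂ => deriv rfun (-p.1 * Complex.exp (-p.2))) 0 :=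
    AnalyticAt.fun_comp (by simpa using analyticAt_rfun_zero.deriv) h₁
  exact (h₂.mul h₃).div analyticAt_const two_ne_zero

theorem contDiffAt_qderiv : ContDiffAt ℂ 1 qderiv 0 := by
  have h₁ : ContDiffAt ℂ 1 qderivRemainder 0 := analyticAt_qderivRemainder.contDiffAt
  unfold qderiv
  fun_prop

theorem fderiv_qderiv_zero :
    fderiv ℂ qderiv 0 ∘L .inr ℂ ℂ ℂ = ContinuousLinearMap.id ℂ ℂ := by
  have h₁ : HasFDerivAt qderiv (fderiv ℂ qderiv 0) ((0 : ℂ), (0 : ℂ)) :=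
    (contDiffAt_qderiv.differentiableAt one_ne_zero).hasFDerivAt
  have h₂ := h₁.comp (0 : ℂ) (hasFDerivAt_prodMk_right (0 : ℂ) (0 : ℂ))
  have h₃ : qderiv ∘ (fun ζ : ℂ => ((0 : ℂ), ζ)) = Complex.sinh := by
    ext ζ
    simp [qderiv]
  rw [h₃] at h₂
  rw [h₂.unique (Complex.hasDerivAt_sinh 0).hasFDerivAt]
  ext
  simp

theorem qderiv_zero : qderiv 0 = 0 := by simp [qderiv]

theorem eventually_norm_le_two_mul_norm_sinh :
    ∀ᶠ z : ℂ in 𝓝 0, ‖z‖ ≤ 2 * ‖Complex.sinh z‖ := by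
  have h := (Complex.hasDerivAt_sinh 0).isLittleO.def (c := 1 / 2) (by norm_num)
  filter_upwards [h] with z hz
  simp only [Complex.sinh_zero, Complex.cosh_zero, sub_zero, smul_eq_mul, mul_one] at hz
  have := norm_sub_norm_le z (Complex.sinh z)
  rw [norm_sub_rev] at this
  linarith

theorem eventually_norm_cosh_sub_one_le :
    ∀ᶠ z : ℂ in 𝓝 0, ‖Complex.cosh z - 1‖ ≤ ‖z‖ := by
  have h := (Complex.hasDerivAt_cosh 0).isLittleO.def (c := 1) one_pos
  filter_upwards [h] with z hz
  simpa using hz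

theorem eventually_norm_le_of_qderiv_eq_zero :
    ∃ K : ℝ, 0 < K ∧ ∀ᶠ p : ℂ × ℂ in 𝓝 0, qderiv p = 0 → ‖p.2‖ ≤ K * ‖p.1‖ ^ 2 := by
  have hG := analyticAt_qderivRemainder.continuousAt.norm.eventually_le_const
    (lt_add_one ‖qderivRemainder 0‖)
  have hs : Tendsto (fun p : ℂ × ℂ => p.2) (𝓝 0) (𝓝 0) := continuous_snd.tendsto (0 : ℂ × ℂ)
  refine ⟨2 * (‖qderivRemainder 0‖ + 1), by positivity, ?_⟩
  filter_upwards [hG, hs.eventually eventually_norm_le_two_mul_norm_sinh] with p hp hp' h0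
  have h : Complex.sinh p.2 = -(p.1 ^ 2 * qderivRemainder p) := eq_neg_of_add_eq_zero_left h0
  rw [h, norm_neg, norm_mul, norm_pow] at hp'
  nlinarith [mul_le_mul_of_nonneg_left hp (sq_nonneg ‖p.1‖)]

theorem eventually_norm_qfun_sub_one_le :
    ∃ K : ℝ, 0 < K ∧ ∀ᶠ p : ℂ × ℂ in 𝓝 0, ‖qfun p.1 p.2 - 1‖ ≤ ‖p.2‖ + K * ‖p.1‖ ^ 2 := by
  obtain ⟨C, hC, hr⟩ := analyticAt_rfun_zero.differentiableAt.isBigO_sub.exists_pos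
  have hs : Tendsto (fun p : ℂ × ℂ => p.2) (𝓝 0) (𝓝 0) := continuous_snd.tendsto (0 : ℂ × ℂ)
  have he : Tendsto (fun p : ℂ × ℂ => ‖Complex.exp (-p.2)‖) (𝓝 0) (𝓝 1) := by
    have h : Continuous fun p : ℂ × ℂ => ‖Complex.exp (-p.2)‖ := by fun_prop
    simpa using h.tendsto 0
  refine ⟨C, hC, ?_⟩
  filter_upwards [hs.eventually eventually_norm_cosh_sub_one_le,
    tendsto_neg_mul_exp.eventually hr.bound, he.eventually_le_const one_lt_two] with p h₁ h₂ h₃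
  rw [rfun_zero, sub_zero, sub_zero, norm_mul, norm_neg] at h₂
  have h₄ : ‖p.1 / 2 * rfun (-p.1 * Complex.exp (-p.2))‖ ≤ C * ‖p.1‖ ^ 2 := by
    rw [norm_mul, norm_div, Complex.norm_ofNat]
    calc ‖p.1‖ / 2 * ‖rfun (-p.1 * Complex.exp (-p.2))‖
        ≤ ‖p.1‖ / 2 * (C * (‖p.1‖ * 2)) := by
          gcongr
          exact h₂.trans (by gcongr)
      _ = C * ‖p.1‖ ^ 2 := by ring
  calc ‖qfun p.1 p.2 - 1‖
      = ‖(Complex.cosh p.2 - 1) + p.1 / 2 * rfun (-p.1 * Complex.exp (-p.2))‖ := by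
        rw [qfun]; congr 1; ring
    _ ≤ ‖p.2‖ + C * ‖p.1‖ ^ 2 := norm_add_le_of_le h₁ h₄

/-- (i) q is holomorphic on {(δ, ζ) : δe^{−ζ} ∉ ℤ*};
(ii) there are δ₁ ∈ (0,1), η₁ > 0 such that for every δ ∈ B(0, δ₁) there is a unique
σ_δ ∈ B(0, η₁) with ∂_ζ q(δ, σ_δ) = 0;
(iii) δ ↦ σ_δ is holomorphic on B(0, δ₁) and real on (−δ₁, δ₁);
(iv) |σ_δ| ≤ K|δ|² and |q(δ, σ_δ) − 1| ≤ K|δ|² on B(0, δ₁/2). -/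
theorem qfun_holomorphic_and_implicit :
    DifferentiableOn ℂ (fun p : ℂ × ℂ => qfun p.1 p.2)
      {p : ℂ × ℂ | ∀ k : ℤ, k ≠ 0 → p.1 * Complex.exp (-p.2) ≠ (k : ℂ)} ∧
    ∃ δ₁ : ℝ, δ₁ ∈ Set.Ioo (0 : ℝ) 1 ∧ ∃ η₁ : ℝ, 0 < η₁ ∧ ∃ σ : ℂ → ℂ,
      (∀ δ ∈ Metric.ball (0 : ℂ) δ₁,
        σ δ ∈ Metric.ball (0 : ℂ) η₁ ∧ deriv (fun ζ => qfun δ ζ) (σ δ) = 0 ∧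
        ∀ ζ ∈ Metric.ball (0 : ℂ) η₁, deriv (fun ζ' => qfun δ ζ') ζ = 0 → ζ = σ δ) ∧
      DifferentiableOn ℂ σ (Metric.ball (0 : ℂ) δ₁) ∧
      (∀ δ : ℝ, |δ| < δ₁ → (σ (δ : ℂ)).im = 0) ∧
      ∃ K : ℝ, 0 < K ∧ ∀ δ ∈ Metric.ball (0 : ℂ) (δ₁ / 2),
        ‖σ δ‖ ≤ K * ‖δ‖ ^ 2 ∧ ‖qfun δ (σ δ) - 1‖ ≤ K * ‖δ‖ ^ 2 := by
  refine ⟨differentiableOn_qfun, ?_⟩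
  have hinv : (fderiv ℂ qderiv 0 ∘L .inr ℂ ℂ ℂ).IsInvertible := by
    rw [fderiv_qderiv_zero]
    exact ⟨.refl ℂ ℂ, rfl⟩
  let σ : ℂ → ℂ := contDiffAt_qderiv.implicitFunction one_ne_zero hinv
  have hσ0 : σ 0 = 0 := contDiffAt_qderiv.implicitFunction_apply_self one_ne_zero hinv
  have hσ : ContDiffAt ℂ 1 σ 0 :=
    contDiffAt_qderiv.contDiffAt_implicitFunction one_ne_zero hinv
  have hiff : ∀ᶠ p : ℂ × ℂ in 𝓝 0, qderiv p = qderiv 0 ↔ σ p.1 = p.2 :=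
    contDiffAt_qderiv.eventually_apply_eq_iff_implicitFunction one_ne_zero hinv
  obtain ⟨K₁, hK₁, hσle⟩ := eventually_norm_le_of_qderiv_eq_zero
  obtain ⟨K₂, hK₂, hqle⟩ := eventually_norm_qfun_sub_one_le
  obtain ⟨η, hη, hball⟩ := Metric.eventually_nhds_iff_ball.1
    (hiff.and (eventually_deriv_qfun.and (hσle.and hqle)))
  have hσball : ∀ᶠ δ in 𝓝 (0 : ℂ), σ δ ∈ Metric.ball (0 : ℂ) η :=
    hσ.continuousAt.eventually (by
      rw [hσ0]
      exact Metric.ball_mem_nhds 0 hη)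
  obtain ⟨ε, hε, hεball⟩ := Metric.eventually_nhds_iff_ball.1
    (hσball.and (hσ.eventually (by simp)))
  let δ₁ := min (min η ε) (1 / 2)
  have hδ₁ : 0 < δ₁ := by positivity
  have hδη : δ₁ ≤ η := (min_le_left _ _).trans (min_le_left _ _)
  have hδε : δ₁ ≤ ε := (min_le_left _ _).trans (min_le_right _ _)
  have hprod : ∀ δ ∈ Metric.ball (0 : ℂ) δ₁, ∀ ζ ∈ Metric.ball (0 : ℂ) η,
      (δ, ζ) ∈ Metric.ball (0 : ℂ × ℂ) η := fun δ hδ ζ hζ => by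
    rw [← Prod.mk_zero_zero, ← ball_prod_same]
    exact ⟨Metric.ball_subset_ball hδη hδ, hζ⟩
  have hmem : ∀ δ ∈ Metric.ball (0 : ℂ) δ₁, σ δ ∈ Metric.ball (0 : ℂ) η := fun δ hδ =>
    (hεball δ (Metric.ball_subset_ball hδε hδ)).1
  have hzero : ∀ δ ∈ Metric.ball (0 : ℂ) δ₁, ∀ ζ ∈ Metric.ball (0 : ℂ) η,
      (deriv (qfun δ) ζ = 0 ↔ σ δ = ζ) := fun δ hδ ζ hζ => by
    obtain ⟨h₁, h₂, -⟩ := hball _ (hprod δ hδ ζ hζ)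
    rw [h₂, ← h₁, qderiv_zero]
  refine ⟨δ₁, ⟨hδ₁, (min_le_right _ _).trans_lt (by norm_num)⟩, η, hη, σ, ?_, ?_, ?_,
    K₁ + K₂, by positivity, ?_⟩
  · exact fun δ hδ => ⟨hmem δ hδ, (hzero δ hδ _ (hmem δ hδ)).2 rfl,
      fun ζ hζ h => ((hzero δ hδ ζ hζ).1 h).symm⟩
  · exact fun δ hδ => ((hεball δ (Metric.ball_subset_ball hδε hδ)).2.differentiableAt
      one_ne_zero).differentiableWithinAt
  · intro δ hδ
    have hδ' : (δ : ℂ) ∈ Metric.ball (0 : ℂ) δ₁ := by simpa using hδ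
    have hc : conj (σ δ) ∈ Metric.ball (0 : ℂ) η := by simpa using hmem _ hδ'
    have h := deriv_qfun_conj δ (σ δ)
    rw [(hzero _ hδ' _ (hmem _ hδ')).2 rfl, Complex.conj_ofReal, map_zero] at h
    exact Complex.conj_eq_iff_im.1 ((hzero _ hδ' _ hc).1 h).symm
  · intro δ hδ
    have hδ' : δ ∈ Metric.ball (0 : ℂ) δ₁ := Metric.ball_subset_ball (by linarith) hδ
    obtain ⟨h₁, -, h₂, h₃⟩ := hball _ (hprod δ hδ' _ (hmem δ hδ'))
    have h₄ : ‖σ δ‖ ≤ K₁ * ‖δ‖ ^ 2 := h₂ ((h₁.2 rfl).trans qderiv_zero)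
    refine ⟨?_, ?_⟩
    · nlinarith [mul_nonneg hK₂.le (sq_nonneg ‖δ‖)]
    · rw [add_mul]
      exact h₃.trans (by gcongr)
end

section
/- Let n ≥ 1 and k₁, k₂ ≥ 0 be integers, let R > 0, T > 0, and set δ = √(R/(πT)), κ = 2√(πTR); assume 0 < δ < 1. Let f(z) = e^{iTz − Rz·coth(z)} · (−1)^{k₁} i^{k₂} z^{n+k₁+k₂} cosh(z)^{k₁} / sinh(z)^{n+k₁}. Then the integral of f over the positively oriented circle of centre πi and radius πδ (which equals 2πi times the residue of f at its pole πi) is equal to ((−1)^{k₂} π^{k₂+1} / δ^{n+k₁−1}) · e^{−R−πT} · ∫_{−π}^{π} e^{κ·cos(s) + R·r(−δe^{is})} · φ_{δ,k₁,k₂}(s) ds. -/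
open Real Complex MeasureTheory intervalIntegral

/-- φ̃_{k₁,k₂}(R, ξ) = e^{R·r(−ξ)} (πξ)^{n+k₁} cos(πξ)^{k₁} (1 − ξ)^{n+k₁+k₂}/sin(πξ)^{n+k₁},
with value 1 at ξ = 0. -/
noncomputable def tphi (n k₁ k₂ : ℕ) (R ξ : ℂ) : ℂ :=
  if ξ = 0 then 1
  else Complex.exp (R * rfun (-ξ)) *
    (((π : ℂ) * ξ) ^ (n + k₁) * Complex.cos ((π : ℂ) * ξ) ^ k₁ * (1 - ξ) ^ (n + k₁ + k₂)
      / Complex.sin ((π : ℂ) * ξ) ^ (n + k₁))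

/-- φ_{δ,k₁,k₂}(s) = e^{−i(n+k₁−1)s} φ̃_{k₁,k₂}(0, δe^{is}). -/
noncomputable def phid (n k₁ k₂ : ℕ) (δ : ℝ) (s : ℝ) : ℂ :=
  Complex.exp (-Complex.I * ((n + k₁ - 1 : ℕ) : ℂ) * (s : ℂ)) *
    tphi n k₁ k₂ 0 ((δ : ℂ) * Complex.exp (Complex.I * (s : ℂ)))

/-- A circle integral, parametrized over `[-π, π]` with the phase shifted by `-π / 2`. -/
theorem circleIntegral_eq_integral_sub_pi_div_two (f : ℂ → ℂ) (c : ℂ) (r : ℝ) :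
    (∮ z in C(c, r), f z) = ∫ s in (-π)..π,
      circleMap 0 r (s - π / 2) * Complex.I * f (circleMap c r (s - π / 2)) := by
  have hper : Function.Periodic
      (fun θ => circleMap 0 r θ * Complex.I * f (circleMap c r θ)) (2 * π) := fun θ => by
    simp only [periodic_circleMap _ _ θ]
  rw [intervalIntegral.integral_comp_sub_right
    (fun θ => circleMap 0 r θ * Complex.I * f (circleMap c r θ)) (π / 2)]
  have h := hper.intervalIntegral_add_eq 0 (-π - π / 2)
  rw [zero_add, show -π - π / 2 + 2 * π = π - π / 2 by ring] at h
  simp only [circleIntegral, deriv_circleMap, smul_eq_mul]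
  exact h

theorem circleMap_pi_mul_I_sub_pi_div_two (δ s : ℝ) :
    circleMap ((π : ℂ) * Complex.I) (π * δ) (s - π / 2)
      = π * Complex.I * (1 - δ * Complex.exp (Complex.I * s)) := by
  have h : Complex.exp (((s - π / 2 : ℝ) : ℂ) * Complex.I)
      = -Complex.I * Complex.exp (Complex.I * s) := by
    rw [show ((s - π / 2 : ℝ) : ℂ) * Complex.I = Complex.I * s - π / 2 * Complex.I by
      push_cast; ring, Complex.exp_sub, Complex.exp_pi_div_two_mul_I, Complex.div_I]
    ring
  rw [circleMap, h]
  push_cast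
  ring

theorem sinh_pi_mul_I_mul_one_sub (ξ : ℂ) :
    Complex.sinh (π * Complex.I * (1 - ξ)) = Complex.I * Complex.sin (π * ξ) := by
  rw [show (π : ℂ) * Complex.I * (1 - ξ) = (π - π * ξ) * Complex.I by ring,
    Complex.sinh_mul_I, Complex.sin_pi_sub, mul_comm]

theorem cosh_pi_mul_I_mul_one_sub (ξ : ℂ) :
    Complex.cosh (π * Complex.I * (1 - ξ)) = -Complex.cos (π * ξ) := by
  rw [show (π : ℂ) * Complex.I * (1 - ξ) = (π - π * ξ) * Complex.I by ring,
    Complex.cosh_mul_I, Complex.cos_pi_sub]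

theorem exponent_eq_rfun_neg (R T ξ : ℂ) (hξ : ξ ≠ 0) :
    Complex.I * T * (π * Complex.I * (1 - ξ)) - R * (π * Complex.I * (1 - ξ)) *
        (-Complex.cos (π * ξ) / (Complex.I * Complex.sin (π * ξ)))
      = (-R - π * T) + (π * T * ξ + R / ξ + R * rfun (-ξ)) := by
  rw [rfun, if_neg (neg_ne_zero.mpr hξ), mul_neg, Complex.cos_neg, Complex.sin_neg,
    mul_comm Complex.I (Complex.sin _), ← div_div, Complex.div_I, div_neg, div_neg]
  linear_combination (π * T * (1 - ξ) - R * π * (1 - ξ) *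
    (Complex.cos (π * ξ) / Complex.sin (π * ξ))) * Complex.I_sq

theorem prefactor_eq_tphi_zero (n k₁ k₂ : ℕ) (ξ : ℂ) (hξ : ξ ≠ 0) :
    (-1 : ℂ) ^ k₁ * Complex.I ^ k₂ * (π * Complex.I * (1 - ξ)) ^ (n + k₁ + k₂) *
        (-Complex.cos (π * ξ)) ^ k₁ / (Complex.I * Complex.sin (π * ξ)) ^ (n + k₁)
      = (-1) ^ k₂ * π ^ k₂ / ξ ^ (n + k₁) * tphi n k₁ k₂ 0 ξ := by
  have hI : Complex.I ^ (n + k₁) ≠ 0 := pow_ne_zero _ Complex.I_ne_zero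
  have hI2 : Complex.I ^ k₂ * Complex.I ^ k₂ = (-1) ^ k₂ := by
    rw [← mul_pow, Complex.I_mul_I]
  have hm : (-1 : ℂ) ^ k₁ * (-1) ^ k₁ = 1 := by rw [← mul_pow]; norm_num
  have hx : ξ ^ (n + k₁) ≠ 0 := pow_ne_zero _ hξ
  rw [tphi, if_neg hξ, zero_mul, Complex.exp_zero, one_mul, neg_pow (Complex.cos _),
    mul_pow Complex.I, mul_pow (π : ℂ) ξ, mul_pow _ (1 - ξ), mul_pow (π : ℂ) Complex.I,
    pow_add (π : ℂ) (n + k₁) k₂, pow_add Complex.I (n + k₁) k₂, ← hI2]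
  generalize (1 - ξ) ^ (n + k₁ + k₂) = a
  calc _ = ((-1 : ℂ) ^ k₁ * (-1) ^ k₁) * (Complex.I ^ (n + k₁) / Complex.I ^ (n + k₁)) *
        (Complex.I ^ k₂ * Complex.I ^ k₂ * π ^ k₂ * π ^ (n + k₁) * a *
          Complex.cos (π * ξ) ^ k₁ / Complex.sin (π * ξ) ^ (n + k₁)) := by ring
    _ = (ξ ^ (n + k₁) / ξ ^ (n + k₁)) *
        (Complex.I ^ k₂ * Complex.I ^ k₂ * π ^ k₂ * π ^ (n + k₁) * a *
          Complex.cos (π * ξ) ^ k₁ / Complex.sin (π * ξ) ^ (n + k₁)) := by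
      rw [hm, div_self hI, div_self hx, one_mul]
    _ = _ := by ring

theorem saddle_exponent_eq (R T δ κ s : ℝ) (hR : 0 < R) (hT : 0 < T)
    (hδ : δ = Real.sqrt (R / (π * T))) (hκ : κ = 2 * Real.sqrt (π * T * R)) :
    (π : ℂ) * T * (δ * Complex.exp (Complex.I * s)) + R / (δ * Complex.exp (Complex.I * s))
      = ((κ * Real.cos s : ℝ) : ℂ) := by
  have hπT : 0 < π * T := by positivity
  have hδpos : 0 < δ := hδ ▸ Real.sqrt_pos.mpr (div_pos hR hπT)
  have hδsq : π * T * δ ^ 2 = R := by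
    rw [hδ, Real.sq_sqrt (div_pos hR hπT).le, mul_div_cancel₀ _ hπT.ne']
  have hκδ : κ = 2 * (π * T * δ) := by
    rw [hκ, ← hδsq, show π * T * (π * T * δ ^ 2) = (π * T * δ) ^ 2 by ring,
      Real.sqrt_sq (by positivity)]
  have hdiv : (R : ℂ) / δ = π * T * δ := by
    rw [← hδsq]
    have : (δ : ℂ) ≠ 0 := by exact_mod_cast hδpos.ne'
    push_cast
    field_simp
  rw [← div_div, hdiv, hκδ, div_eq_mul_inv, ← Complex.exp_neg]
  push_cast
  rw [Complex.cos, mul_comm Complex.I (s : ℂ), neg_mul]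
  ring

/-- The circle integral of f around πi with radius πδ equals
(−1)^{k₂} π^{k₂+1} δ^{−(n+k₁−1)} e^{−R−πT} ∫_{−π}^{π} e^{κcos s + R r(−δe^{is})} φ_{δ,k₁,k₂}(s) ds. -/
theorem residue_at_pi_i (n k₁ k₂ : ℕ) (hn : 1 ≤ n) (R T : ℝ) (hR : 0 < R) (hT : 0 < T)
    (δ κ : ℝ) (hδ : δ = Real.sqrt (R / (π * T))) (hκ : κ = 2 * Real.sqrt (π * T * R))
    (hδ1 : δ < 1) :
    (∮ z in C((π : ℂ) * Complex.I, π * δ),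
        Complex.exp (Complex.I * (T : ℂ) * z
            - (R : ℂ) * z * (Complex.cosh z / Complex.sinh z)) *
          ((-1 : ℂ) ^ k₁ * Complex.I ^ k₂ * z ^ (n + k₁ + k₂) *
            Complex.cosh z ^ k₁ / Complex.sinh z ^ (n + k₁)))
      = ((-1 : ℂ) ^ k₂ * (π : ℂ) ^ (k₂ + 1) / (δ : ℂ) ^ (n + k₁ - 1)) *
          Complex.exp (-(R : ℂ) - (π : ℂ) * (T : ℂ)) *
          ∫ s in (-π)..π,
            Complex.exp (((κ * Real.cos s : ℝ) : ℂ)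
                + (R : ℂ) * rfun (-(δ : ℂ) * Complex.exp (Complex.I * (s : ℂ)))) *
              phid n k₁ k₂ δ s := by
  have hδpos : 0 < δ := hδ ▸ Real.sqrt_pos.mpr (by positivity)
  rw [circleIntegral_eq_integral_sub_pi_div_two, ← intervalIntegral.integral_const_mul]
  refine intervalIntegral.integral_congr fun s _ => ?_
  have hδ0 : (δ : ℂ) ≠ 0 := by exact_mod_cast hδpos.ne'
  have hc : circleMap 0 (π * δ) (s - π / 2) * Complex.I
      = π * (δ * Complex.exp (Complex.I * s)) := by
    rw [← circleMap_sub_center ((π : ℂ) * Complex.I), circleMap_pi_mul_I_sub_pi_div_two]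
    linear_combination -π * δ * Complex.exp (Complex.I * s) * Complex.I_sq
  obtain ⟨m, hm⟩ : ∃ m, n + k₁ = m + 1 := ⟨n + k₁ - 1, by omega⟩
  have hexp : Complex.exp (-Complex.I * (m : ℂ) * s) = (Complex.exp (Complex.I * s) ^ m)⁻¹ := by
    rw [← Complex.exp_nat_mul, ← Complex.exp_neg]
    ring_nf
  simp only [hc, circleMap_pi_mul_I_sub_pi_div_two, phid, neg_mul (δ : ℂ),
    sinh_pi_mul_I_mul_one_sub, cosh_pi_mul_I_mul_one_sub]
  have hξ : (δ : ℂ) * Complex.exp (Complex.I * s) ≠ 0 := mul_ne_zero hδ0 (Complex.exp_ne_zero _)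
  rw [exponent_eq_rfun_neg _ _ _ hξ, prefactor_eq_tphi_zero _ _ _ _ hξ,
    saddle_exponent_eq R T δ κ s hR hT hδ hκ, Complex.exp_add, hm, Nat.add_sub_cancel, hexp]
  have he : Complex.exp (Complex.I * s) ≠ 0 := Complex.exp_ne_zero _
  field_simp
  ring
end
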